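/- Let k ≥ 3 and g ≥ 3 be integers and let G, with vertex subset N_0 and levels N_0, N_1, …, N_D, be a graph that is repeatable with respect to k and g. Then f(k,g) ≤ |N_0 ∪ N_1 ∪ … ∪ N_{D−g}| / (D+1−g). -/

import Mathlib

/-- A graph is `k`-regular: every vertex has exactly `k` neighbours. -/
def IsRegular' (k : ℕ) {V : Type*} (G : SimpleGraph V) : Prop :=
  ∀ v : V, (G.neighborSet v).ncard = k

/-- A `(k; g, d)`-graph: a `k`-regular simple graph of girth exactly `g` and
diameter exactly `d`. -/
def IsKGDGraph (k g d : ℕ) {V : Type*} (G : SimpleGraph V) : Prop :=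
  IsRegular' k G ∧ G.egirth = g ∧ G.ediam = d

/-- `f(k,g)`: the infimum of all real `c` for which there is a constant `C` such that
for every sufficiently large `d` there is a `(k; g, d)`-graph with at most `c·d + C`
vertices. -/
noncomputable def fRatio (k g : ℕ) : ℝ :=
  sInf {c : ℝ | ∃ C : ℝ, ∃ d₀ : ℕ, ∀ d : ℕ, d₀ ≤ d →
    ∃ n : ℕ, (n : ℝ) ≤ c * d + C ∧ ∃ G : SimpleGraph (Fin n), IsKGDGraph k g d G}

/-- `levelSet G N0 i`: the set of vertices whose minimum distance to the set `N0` is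
exactly `i`. -/
noncomputable def levelSet {V : Type*} (G : SimpleGraph V) (N0 : Set V) (i : ℕ) : Set V :=
  {v : V | (⨅ u ∈ N0, G.edist u v) = (i : ℕ∞)}

/-- `G`, with levels `N₀, N₁, …, N_D` determined by the vertex subset `N0`,
is repeatable with respect to `k` and `g`. -/
structure IsRepeatable (k g : ℕ) {V : Type*} [Fintype V] (G : SimpleGraph V)
    (N0 : Set V) (D : ℕ) : Prop where
  /-- `N_D` is nonempty -/
  top_nonempty : (levelSet G N0 D).Nonempty
  /-- `D` is the largest index with `N_D` nonempty -/
  top_largest : ∀ i : ℕ, D < i → levelSet G N0 i = ∅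
  /-- (1) `G` has girth at least `g` -/
  girth_ge : (g : ℕ∞) ≤ G.egirth
  /-- (2) every vertex in `N_1 ∪ … ∪ N_{D-1}` has degree `k` -/
  middle_regular : ∀ i : ℕ, 1 ≤ i → i ≤ D - 1 →
    ∀ v ∈ levelSet G N0 i, (G.neighborSet v).ncard = k
  /-- (3) if `k` is even, the sum of the degrees of the vertices in `N_0` is even -/
  parity_first : Even k → Even (∑ᶠ v ∈ levelSet G N0 0, (G.neighborSet v).ncard)
  /-- (4) if `k` is even, the sum of the degrees of the vertices in `N_D` is even -/
  parity_last : Even k → Even (∑ᶠ v ∈ levelSet G N0 D, (G.neighborSet v).ncard)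
  /-- (5) `D + 1 ≥ 2g` -/
  long : 2 * g ≤ D + 1
  /-- (6) there is an isomorphism between the subgraphs induced on
  `N_0 ∪ … ∪ N_{g-1}` and on `N_{D-g+1} ∪ … ∪ N_D` mapping, for each `0 ≤ ℓ ≤ g-1`,
  every vertex of `N_ℓ` to a vertex of `N_{ℓ+D-g+1}` -/
  iso : ∃ φ : SimpleGraph.induce (⋃ ℓ ∈ Finset.range g, levelSet G N0 ℓ) G ≃g
      SimpleGraph.induce (⋃ ℓ ∈ Finset.range g, levelSet G N0 (ℓ + (D + 1 - g))) G,
    ∀ (x : (⋃ ℓ ∈ Finset.range g, levelSet G N0 ℓ : Set V)) (ℓ : ℕ), ℓ < g →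
      (x : V) ∈ levelSet G N0 ℓ → ((φ x : V) ∈ levelSet G N0 (ℓ + (D + 1 - g)))

open SimpleGraph

universe u

/-- The number of neighbours of a vertex. -/
noncomputable abbrev ncdeg {V : Type*} (G : SimpleGraph V) (v : V) : ℕ := (G.neighborSet v).ncard

/-- A vertex labelling that changes by at most one along every edge. -/
def IsLip {V : Type*} (G : SimpleGraph V) (f : V → ℕ) : Prop :=
  ∀ a b, G.Adj a b → f b ≤ f a + 1

/-- `f` witnesses that every path from `u` to `v` avoiding the edge `uv` has length at
least `N`. -/
def IsEdgeCert {V : Type*} (N : ℕ) (G : SimpleGraph V) (u v : V) (f : V → ℕ) : Prop :=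
  f u = 0 ∧ f v = N ∧ (∀ a, f a ≤ N) ∧ ∀ a b, G.Adj a b → s(a, b) ≠ s(u, v) → f b ≤ f a + 1

/-- Every edge has a certificate that each cycle through it has length greater than `N`. -/
def GirthCert {V : Type*} (N : ℕ) (G : SimpleGraph V) : Prop :=
  ∀ u v, G.Adj u v → ∃ f : V → ℕ, IsEdgeCert N G u v f

theorem IsEdgeCert.symm {V : Type*} {N : ℕ} {G : SimpleGraph V} {u v : V} {f : V → ℕ}
    (h : IsEdgeCert N G u v f) : IsEdgeCert N G v u (fun a => N - f a) := by
  obtain ⟨h0, h1, h2, h3⟩ := h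
  refine ⟨by simp [h1], by simp [h0], fun a => Nat.sub_le _ _, fun a b hab hne => ?_⟩
  have := h3 b a hab.symm (by rw [Sym2.eq_swap]; rwa [Sym2.eq_swap (a := v)] at hne)
  have := h2 a
  have := h2 b
  show N - f b ≤ N - f a + 1
  omega

theorem IsLip.le_add_length {V : Type*} {G : SimpleGraph V} {f : V → ℕ} (hf : IsLip G f)
    {a b : V} (p : G.Walk a b) : f b ≤ f a + p.length := by
  induction p with
  | nil => simp
  | cons h p ih =>
    have := hf _ _ h
    simp only [Walk.length_cons]
    omega

theorem IsLip.le_add_dist {V : Type*} {G : SimpleGraph V} {f : V → ℕ} (hf : IsLip G f)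
    (hG : G.Connected) (a b : V) : f b ≤ f a + G.dist a b := by
  obtain ⟨p, hp⟩ := hG.exists_walk_length_eq_dist a b
  rw [← hp]
  exact hf.le_add_length p

theorem IsEdgeCert.le_length {V : Type*} {N : ℕ} {G : SimpleGraph V} {u v : V} {f : V → ℕ}
    (h : IsEdgeCert N G u v f) {a b : V} (p : G.Walk a b) (hp : s(u, v) ∉ p.edges) :
    f b ≤ f a + p.length := by
  induction p with
  | nil => simp
  | cons hadj p ih =>
    simp only [Walk.edges_cons, List.mem_cons, not_or] at hp
    have := ih hp.2
    have := h.2.2.2 _ _ hadj (Ne.symm hp.1)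
    simp only [Walk.length_cons]
    omega

theorem GirthCert.le_egirth {V : Type*} {N : ℕ} {G : SimpleGraph V} (h : GirthCert N G) :
    ((N + 1 : ℕ) : ℕ∞) ≤ G.egirth := by
  rw [SimpleGraph.le_egirth]
  intro a w hw
  cases w with
  | nil => exact absurd hw Walk.not_isCycle_nil
  | @cons _ b _ hab p =>
    rw [Walk.cons_isCycle_iff] at hw
    obtain ⟨f, hf⟩ := h _ _ hab.symm
    have := hf.le_length p (by rw [Sym2.eq_swap]; exact hw.2)
    rw [hf.1, hf.2.1] at this
    simp only [Walk.length_cons]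
    exact_mod_cast (by omega)

theorem girthCert_of_le_egirth {V : Type*} {N : ℕ} {G : SimpleGraph V}
    (h : ((N + 1 : ℕ) : ℕ∞) ≤ G.egirth) : GirthCert N G := by
  classical
  intro u v huv
  set G' := G.deleteEdges {s(u, v)} with hG'
  let F : V → ℕ∞ := fun z => min N (G'.edist u z)
  have hF : ∀ z, F z ≤ N := fun z => min_le_left _ _
  have hFt : ∀ z, F z ≠ ⊤ := fun z => ne_top_of_le_ne_top (ENat.natCast_ne_top N) (hF z)
  have hc : ∀ z, ((F z).toNat : ℕ∞) = F z := fun z => ENat.natCast_toNat (hFt z)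
  refine ⟨fun z => (F z).toNat, by simp [F], ?_, ?_, ?_⟩
  · have : (N : ℕ∞) ≤ G'.edist u v := by
      by_contra hlt
      rw [not_le] at hlt
      obtain ⟨p, hp⟩ := SimpleGraph.exists_walk_of_edist_ne_top hlt.ne_top
      have hq := p.bypass_isPath
      have hle := p.length_bypass_le_length
      set q := p.bypass
      have hle' : G' ≤ G := G.deleteEdges_le _
      have hcyc : (Walk.cons huv.symm (q.mapLe hle')).IsCycle := by
        rw [Walk.cons_isCycle_iff]
        refine ⟨(Walk.isPath_mapLe hle').2 hq, fun hmem => ?_⟩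
        rw [Walk.edges_mapLe_eq_edges] at hmem
        have := Walk.edges_subset_edgeSet _ hmem
        rw [hG', SimpleGraph.edgeSet_deleteEdges] at this
        exact this.2 (by simp [Sym2.eq_swap])
      have h2 := (SimpleGraph.le_egirth.1 h) _ _ hcyc
      rw [← hp] at hlt
      simp only [Walk.length_cons, Walk.length_mapLe] at h2
      have h3 : N + 1 ≤ q.length + 1 := by exact_mod_cast h2
      have h4 : p.length < N := by exact_mod_cast hlt
      omega
    simp [F, this]
  · intro a
    exact ENat.toNat_le_of_le_natCast (hF a)
  · intro a b hab hne
    have hadj : G'.Adj a b := by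
      rw [hG', SimpleGraph.deleteEdges_adj]
      exact ⟨hab, by simpa using hne⟩
    have : F b ≤ F a + 1 := by
      have h1 : G'.edist u b ≤ G'.edist u a + 1 := by
        refine G'.edist_triangle (v := a) |>.trans ?_
        rw [SimpleGraph.edist_eq_one_iff_adj.2 hadj]
      simp only [F]
      rcases le_total (N : ℕ∞) (G'.edist u a) with h2 | h2
      · rw [min_eq_left h2]
        exact (min_le_left _ _).trans le_self_add
      · rw [min_eq_right h2]
        exact (min_le_right _ _).trans h1
    rw [← hc b, ← hc a] at this
    exact_mod_cast this

/-- Reduced words of length at most `r` over an alphabet of `k` letters. -/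
abbrev RedWord (k r : ℕ) : Type :=
  {l : List (Fin k) // l.IsChain (· ≠ ·) ∧ l.length ≤ r}

namespace RedWord

variable {k r : ℕ}

instance : Finite (RedWord k r) :=
  Set.Finite.subset (List.finite_length_le (Fin k) r) (fun _ hl => hl.2)

/-- The partial left multiplication by a letter: cancel it, or prepend it if there is room. -/
def flip (a : Fin k) (l : RedWord k r) : RedWord k r :=
  match l with
  | ⟨[], h⟩ => if hr : 0 < r then ⟨[a], by simp; omega⟩ else ⟨[], h⟩
  | ⟨b :: l, h⟩ =>
    if hab : a = b then ⟨l, h.1.tail, by have := h.2; simp at this; omega⟩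
    else if hr : (b :: l).length < r then
      ⟨a :: b :: l, by
        refine ⟨List.isChain_cons_cons.2 ⟨hab, h.1⟩, ?_⟩
        simp only [List.length_cons] at hr ⊢; omega⟩
    else ⟨b :: l, h⟩

theorem flip_flip (a : Fin k) (l : RedWord k r) : flip a (flip a l) = l := by
  obtain ⟨l, h⟩ := l
  cases l with
  | nil =>
    by_cases hr : 0 < r <;> simp [flip, hr]
  | cons b l =>
    by_cases hab : a = b
    · subst hab
      cases l with
      | nil =>
        have : 0 < r := by have := h.2; simp at this; omega
        simp [flip, this]
      | cons c l =>
        have h1 : a ≠ c := (List.isChain_cons_cons.1 h.1).1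
        have h2 : l.length + 1 < r := by have := h.2; simp at this; omega
        simp [flip, h1, h2]
    · by_cases hr : l.length + 1 < r <;> simp [flip, hab, hr]

/-- The empty word. -/
def nil : RedWord k r := ⟨[], by simp⟩

theorem flip_val (a : Fin k) (l : RedWord k r) (hr : l.1.length < r)
    (h : ∀ b ∈ l.1.head?, a ≠ b) : (flip a l).1 = a :: l.1 := by
  obtain ⟨l, hl⟩ := l
  cases l with
  | nil => simp at hr; simp [flip, hr]
  | cons b l =>
    simp at h hr
    simp [flip, h, hr]

/-- The involution of the set of reduced words attached to a letter. -/
def perm (a : Fin k) : Equiv.Perm (RedWord k r) :=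
  Function.Involutive.toPerm (flip a) (flip_flip a)

@[simp] theorem perm_apply (a : Fin k) (l : RedWord k r) : perm a l = flip a l := rfl

theorem perm_mul_perm (a : Fin k) : (perm a : Equiv.Perm (RedWord k r)) * perm a = 1 := by
  ext1 l
  simp [flip_flip]

theorem flip_nil (hr : 0 < r) (a : Fin k) : (flip a (nil : RedWord k r)).1 = [a] := by
  simp [flip, nil, hr]

/-- The Cayley graph of the letter involutions on the permutations of reduced words. -/
def cayley (k r : ℕ) : SimpleGraph (Equiv.Perm (RedWord k r)) where
  Adj p q := p ≠ q ∧ ∃ a : Fin k, q = perm a * p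
  symm := ⟨by
    rintro p q ⟨hne, a, rfl⟩
    exact ⟨hne.symm, a, by rw [← mul_assoc, perm_mul_perm, one_mul]⟩⟩
  loopless := ⟨fun p h => h.1 rfl⟩

theorem perm_injective (hr : 0 < r) :
    Function.Injective (perm : Fin k → Equiv.Perm (RedWord k r)) := by
  intro a b hab
  have h := congrArg (fun σ : Equiv.Perm (RedWord k r) => (σ nil).1) hab
  simpa [flip_nil hr] using h

theorem ncdeg_cayley (hr : 0 < r) (p : Equiv.Perm (RedWord k r)) :
    ncdeg (cayley k r) p = k := by
  have h : (cayley k r).neighborSet p = Set.range (fun a : Fin k => perm a * p) := by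
    ext q
    simp only [mem_neighborSet, cayley, Set.mem_range]
    constructor
    · rintro ⟨-, a, rfl⟩
      exact ⟨a, rfl⟩
    · rintro ⟨a, rfl⟩
      refine ⟨fun h => ?_, a, rfl⟩
      have h1 : (perm a : Equiv.Perm (RedWord k r)) = 1 := by
        rw [← mul_right_cancel_iff (a := p), one_mul]; exact h.symm
      have h2 : (flip a (nil : RedWord k r)).1 = nil.1 :=
        congrArg (fun σ : Equiv.Perm (RedWord k r) => (σ nil).1) h1
      rw [flip_nil hr] at h2
      exact List.cons_ne_nil _ _ h2
  rw [ncdeg, h, ← Set.image_univ, Set.ncard_image_of_injective, Set.ncard_univ, Nat.card_fin]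
  exact (mul_left_injective p).comp (perm_injective hr)

theorem trail_length {p q : Equiv.Perm (RedWord k r)} (w : (cayley k r).Walk p q)
    (hw : w.IsTrail) (hr : w.length ≤ r) :
    (p (q⁻¹ nil)).1.length = w.length ∧
      ∀ b ∈ (p (q⁻¹ nil)).1.head?, s(p, perm b * p) ∈ w.edges := by
  induction w with
  | nil =>
    rw [show ∀ (u : Equiv.Perm (RedWord k r)) z, u (u⁻¹ z) = z from fun u z => u.apply_symm_apply z]
    simp [nil]
  | @cons p p' q h w ih =>
    rw [Walk.isTrail_cons] at hw
    simp only [Walk.length_cons] at hr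
    obtain ⟨ih1, ih2⟩ := ih hw.1 (by omega)
    obtain ⟨hne, a, ha⟩ := h.symm
    have hval : (p (q⁻¹ nil)).1 = a :: (p' (q⁻¹ nil)).1 := by
      rw [ha]
      refine flip_val a _ (by omega) fun b hb hab => ?_
      subst hab
      have := ih2 a hb
      rw [← ha, Sym2.eq_swap] at this
      exact hw.2 this
    rw [hval]
    refine ⟨by rw [List.length_cons, ih1, Walk.length_cons], fun b hb => ?_⟩
    simp at hb
    subst hb
    have : perm a * p = p' := by rw [ha, ← mul_assoc, perm_mul_perm, one_mul]
    simp [this]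

theorem le_egirth_cayley : ((r + 1 : ℕ) : ℕ∞) ≤ (cayley k r).egirth := by
  rw [SimpleGraph.le_egirth]
  intro p w hw
  by_contra hlt
  rw [not_le] at hlt
  have hlt' : w.length < r + 1 := by exact_mod_cast hlt
  have h := (trail_length w hw.isTrail (by omega)).1
  have h3 := hw.three_le_length
  rw [show p (p⁻¹ nil) = nil from p.apply_symm_apply nil] at h
  simp [nil] at h
  omega

end RedWord

/-- A connected graph obtained from a `k`-regular graph of girth greater than `N` by removing
the edge `xy`. -/
structure IsGadget (k N : ℕ) {K : Type} (G : SimpleGraph K) (x y : K) : Prop where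
  ne : x ≠ y
  conn : G.Connected
  deg_x : ncdeg G x + 1 = k
  deg_y : ncdeg G y + 1 = k
  deg : ∀ z, z ≠ x → z ≠ y → ncdeg G z = k
  height : ∃ D : K → ℕ, D x = 0 ∧ D y = N ∧ (∀ z, D z ≤ N) ∧ IsLip G D
  cert : ∀ p q, G.Adj p q → ∃ f : K → ℕ, IsEdgeCert N G p q f ∧ f y ≤ f x + 1 ∧ f x ≤ f y + 1

theorem not_isAcyclic_of_two_le {V : Type*} [Finite V] [Nonempty V] (G : SimpleGraph V)
    (h : ∀ v, 2 ≤ ncdeg G v) : ¬ G.IsAcyclic := by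
  classical
  intro hac
  have := Fintype.ofFinite V
  obtain ⟨v⟩ := ‹Nonempty V›
  let C := G.connectedComponentMk v
  have hT : C.toSimpleGraph.IsTree := hac.isTree_connectedComponent C
  have hdeg : ∀ z : C, 2 ≤ C.toSimpleGraph.degree z := by
    intro z
    refine (h z).trans ?_
    rw [← C.toSimpleGraph.card_neighborFinset_eq_degree, ← Set.ncard_coe_finset,
      coe_neighborFinset]
    have : G.neighborSet z ⊆ (Subtype.val : C → V) '' C.toSimpleGraph.neighborSet z := by
      intro y hy
      have hyC : y ∈ C := C.mem_supp_of_adj_mem_supp z.2 hy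
      exact ⟨⟨y, hyC⟩, by simpa [ConnectedComponent.toSimpleGraph] using hy, rfl⟩
    refine (Set.ncard_le_ncard this (Set.toFinite _)).trans (Set.ncard_image_le (Set.toFinite _))
  have : Nontrivial C := by
    have h2 := hdeg ⟨v, rfl⟩
    have : 0 < C.toSimpleGraph.degree ⟨v, rfl⟩ := by omega
    obtain ⟨w, hw⟩ := (C.toSimpleGraph.degree_pos_iff_exists_adj _).1 this
    exact ⟨_, w, hw.ne⟩
  obtain ⟨z, hz⟩ := hT.exists_vert_degree_one_of_nontrivial
  have := hdeg z
  omega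

theorem exists_gadget (k N : ℕ) (hk : 3 ≤ k) :
    ∃ (K : Type) (_ : Finite K) (G : SimpleGraph K) (x y : K), IsGadget k N G x y := by
  classical
  let r := N + 1
  let R := RedWord.cayley k r
  have hdegR : ∀ p, ncdeg R p = k := fun p => RedWord.ncdeg_cayley (by omega) p
  have hgR : GirthCert N R := girthCert_of_le_egirth
    (le_trans (by exact_mod_cast (by omega)) RedWord.le_egirth_cayley)
  have hnac : ¬ R.IsAcyclic :=
    not_isAcyclic_of_two_le _ (fun v => by rw [hdegR]; omega)
  rw [isAcyclic_iff_forall_isBridge] at hnac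
  push Not at hnac
  obtain ⟨e, he, hb⟩ := hnac
  induction e using Sym2.ind with
  | _ x y =>
  rw [mem_edgeSet] at he
  rw [isBridge_iff, not_not] at hb
  set R' := R.deleteEdges {s(x, y)} with hR'
  have hR'adj : ∀ a b, R'.Adj a b ↔ R.Adj a b ∧ s(a, b) ≠ s(x, y) := by
    intro a b
    rw [hR', deleteEdges_adj, Set.mem_singleton_iff]
  let C := R'.connectedComponentMk x
  have hxC : x ∈ C := rfl
  have hyC : y ∈ C := ConnectedComponent.sound hb.symm
  have hCadj : ∀ a b : C, C.toSimpleGraph.Adj a b ↔ R.Adj a b ∧ s(a.1, b.1) ≠ s(x, y) := by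
    intro a b
    rw [← hR'adj]
    rfl
  have hdegC : ∀ z : C, ncdeg C.toSimpleGraph z = (R'.neighborSet z).ncard := by
    intro z
    rw [ncdeg, ← Set.ncard_image_of_injective _ Subtype.val_injective]
    congr 1
    ext w
    constructor
    · rintro ⟨w, hw, rfl⟩
      exact hw
    · intro hw
      exact ⟨⟨w, C.mem_supp_of_adj_mem_supp z.2 hw⟩, hw, rfl⟩
  have hdel : ∀ a b, R.Adj a b → s(a, b) = s(x, y) →
      (R'.neighborSet a).ncard + 1 = k := by
    intro a b hab hs
    refine Eq.trans ?_ (hdegR a)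
    rw [ncdeg, ← Set.ncard_sdiff_singleton_add_one (s := R.neighborSet a) (a := b) hab
      (Set.toFinite _)]
    congr 2
    ext w
    simp only [mem_neighborSet, hR'adj, Set.mem_sdiff, Set.mem_singleton_iff, ← hs]
    refine and_congr_right fun _ => ?_
    have := hab.ne
    simp [this]
  refine ⟨C, inferInstance, C.toSimpleGraph, ⟨x, hxC⟩, ⟨y, hyC⟩, ?_, ?_, ?_, ?_, ?_, ?_, ?_⟩
  · intro h
    exact he.ne (congrArg Subtype.val h)
  · exact C.connected_toSimpleGraph
  · rw [hdegC]
    exact hdel x y he rfl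
  · rw [hdegC]
    exact hdel y x he.symm Sym2.eq_swap
  · intro z hzx hzy
    rw [hdegC]
    refine Eq.trans ?_ (hdegR z)
    rw [ncdeg]
    congr 1
    ext w
    simp only [mem_neighborSet, hR'adj]
    refine and_iff_left fun hs => ?_
    rcases Sym2.eq_iff.1 hs with h | h
    · exact hzx (Subtype.ext h.1)
    · exact hzy (Subtype.ext h.1)
  · obtain ⟨f, h0, h1, h2, h3⟩ := hgR x y he
    refine ⟨fun z => f z, h0, h1, fun z => h2 z, fun a b hab => ?_⟩
    exact h3 _ _ ((hCadj a b).1 hab).1 ((hCadj a b).1 hab).2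
  · intro p q hpq
    have hpq' := (hCadj p q).1 hpq
    obtain ⟨f, h0, h1, h2, h3⟩ := hgR p q hpq'.1
    refine ⟨fun z => f z, ⟨h0, h1, fun z => h2 z, fun a b hab hne => ?_⟩, ?_, ?_⟩
    · refine h3 _ _ ((hCadj a b).1 hab).1 fun h => hne ?_
      rcases Sym2.eq_iff.1 h with h | h
      · rw [Subtype.ext h.1, Subtype.ext h.2]
      · rw [Subtype.ext h.1, Subtype.ext h.2, Sym2.eq_swap]
    · exact h3 _ _ he hpq'.2.symm
    · exact h3 _ _ he.symm (by rw [Sym2.eq_swap]; exact hpq'.2.symm)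

/-- Attach to `H`, for every index `i`, a disjoint copy of `Gk` whose vertices `x` and `y` are
joined to `s i` and `t i`. -/
def fatten {V ι K : Type*} (H : SimpleGraph V) (s t : ι → V) (Gk : SimpleGraph K) (x y : K) :
    SimpleGraph (V ⊕ ι × K) where
  Adj
    | .inl a, .inl b => H.Adj a b
    | .inl a, .inr (i, z) => (a = s i ∧ z = x) ∨ (a = t i ∧ z = y)
    | .inr (i, z), .inl a => (a = s i ∧ z = x) ∨ (a = t i ∧ z = y)
    | .inr (i, z), .inr (j, z') => i = j ∧ Gk.Adj z z'
  symm := ⟨by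
    rintro (a | ⟨i, z⟩) (b | ⟨j, z'⟩) h
    · exact H.adj_symm h
    · exact h
    · exact h
    · exact ⟨h.1.symm, h.2.symm⟩⟩
  loopless := ⟨by
    rintro (a | ⟨i, z⟩) h
    · exact H.loopless.irrefl a h
    · exact Gk.loopless.irrefl z h.2⟩

section fatten

variable {V : Type*} {ι K : Type} {H : SimpleGraph V} {s t : ι → V} {Gk : SimpleGraph K} {x y : K}

theorem fatten_inl_inl {a b : V} :
    (fatten H s t Gk x y).Adj (.inl a) (.inl b) ↔ H.Adj a b := Iff.rfl

theorem fatten_inl_inr {a : V} {i : ι} {z : K} :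
    (fatten H s t Gk x y).Adj (.inl a) (.inr (i, z)) ↔ (a = s i ∧ z = x) ∨ (a = t i ∧ z = y) :=
  Iff.rfl

theorem fatten_inr_inl {a : V} {i : ι} {z : K} :
    (fatten H s t Gk x y).Adj (.inr (i, z)) (.inl a) ↔ (a = s i ∧ z = x) ∨ (a = t i ∧ z = y) :=
  Iff.rfl

theorem fatten_inr_inr {i j : ι} {z z' : K} :
    (fatten H s t Gk x y).Adj (.inr (i, z)) (.inr (j, z')) ↔ i = j ∧ Gk.Adj z z' := Iff.rfl

theorem ncdeg_fatten_inl [Finite V] [Finite ι] [Finite K] (hne : x ≠ y) (v : V) :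
    ncdeg (fatten H s t Gk x y) (.inl v) =
      ncdeg H v + {i | s i = v}.ncard + {i | t i = v}.ncard := by
  have h : (fatten H s t Gk x y).neighborSet (.inl v) =
      (Sum.inl '' H.neighborSet v ∪ (fun i => Sum.inr (i, x)) '' {i | s i = v}) ∪
        (fun i => Sum.inr (i, y)) '' {i | t i = v} := by
    ext (a | ⟨i, z⟩)
    · simp [fatten_inl_inl]
    · simp only [mem_neighborSet, fatten_inl_inr]
      simp [eq_comm]
  have hd1 : Disjoint (Sum.inl '' H.neighborSet v : Set (V ⊕ ι × K))
      ((fun i => Sum.inr (i, x)) '' {i | s i = v}) := by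
    rw [Set.disjoint_left]
    rintro _ ⟨a, _, rfl⟩ ⟨i, _, h⟩
    cases h
  have hd2 : Disjoint (Sum.inl '' H.neighborSet v ∪ (fun i => Sum.inr (i, x)) '' {i | s i = v} :
      Set (V ⊕ ι × K)) ((fun i => Sum.inr (i, y)) '' {i | t i = v}) := by
    rw [Set.disjoint_left]
    rintro _ (⟨a, _, rfl⟩ | ⟨j, _, rfl⟩) ⟨i, _, h⟩
    · cases h
    · simp only [Sum.inr.injEq, Prod.mk.injEq] at h
      exact hne h.2.symm
  rw [ncdeg, h, Set.ncard_union_eq hd2, Set.ncard_union_eq hd1,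
    Set.ncard_image_of_injective _ Sum.inl_injective, Set.ncard_image_of_injective,
    Set.ncard_image_of_injective]
  · intro i j hij
    simpa using hij
  · intro i j hij
    simpa using hij

theorem ncdeg_fatten_inr [Finite V] [Finite ι] [Finite K] {k N : ℕ} (hg : IsGadget k N Gk x y)
    (i : ι) (z : K) : ncdeg (fatten H s t Gk x y) (.inr (i, z)) = k := by
  have h0 : (Sum.inl ⁻¹' (fatten H s t Gk x y).neighborSet (.inr (i, z))) =
      {a | (a = s i ∧ z = x) ∨ (a = t i ∧ z = y)} := rfl
  have h : (fatten H s t Gk x y).neighborSet (.inr (i, z)) =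
      Sum.inl '' {a | (a = s i ∧ z = x) ∨ (a = t i ∧ z = y)} ∪
        (fun z' => Sum.inr (i, z')) '' Gk.neighborSet z := by
    ext (a | ⟨j, z'⟩)
    · simp [fatten_inr_inl]
    · simp only [mem_neighborSet, fatten_inr_inr]
      simp [eq_comm, and_comm]
  have hd : Disjoint (Sum.inl '' {a | (a = s i ∧ z = x) ∨ (a = t i ∧ z = y)} : Set (V ⊕ ι × K))
      ((fun z' => Sum.inr (i, z')) '' Gk.neighborSet z) := by
    rw [Set.disjoint_left]
    rintro _ ⟨a, _, rfl⟩ ⟨i, _, h⟩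
    cases h
  rw [ncdeg, h, Set.ncard_union_eq hd, Set.ncard_image_of_injective _ Sum.inl_injective,
    Set.ncard_image_of_injective]
  · by_cases hzx : z = x
    · subst hzx
      have : {a | (a = s i ∧ z = z) ∨ (a = t i ∧ z = y)} = {s i} := by
        ext a; simp [hg.ne]
      rw [this, Set.ncard_singleton, add_comm]
      exact hg.deg_x
    · by_cases hzy : z = y
      · subst hzy
        have : {a | (a = s i ∧ z = x) ∨ (a = t i ∧ z = z)} = {t i} := by
          ext a; simp [hzx]
        rw [this, Set.ncard_singleton, add_comm]
        exact hg.deg_y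
      · have : {a | (a = s i ∧ z = x) ∨ (a = t i ∧ z = y)} = ∅ := by
          ext a; simp [hzx, hzy]
        rw [this, Set.ncard_empty, zero_add]
        exact hg.deg z hzx hzy
  · intro i j hij
    simpa using hij

theorem girthCert_fatten {k N : ℕ} (hg : IsGadget k N Gk x y) (hH : GirthCert N H) :
    GirthCert N (fatten H s t Gk x y) := by
  classical
  obtain ⟨D, D0, D1, D2, D3⟩ := hg.height
  have hs : ∀ i, ∃ f, IsEdgeCert N (fatten H s t Gk x y) (.inl (s i)) (.inr (i, x)) f := by
    intro i
    refine ⟨Sum.elim (fun _ => 0) (fun p => if p.1 = i then N - D p.2 else 0), by simp,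
      by simp [D0], ?_, ?_⟩
    · rintro (a | ⟨j, z⟩)
      · simp
      · simp only [Sum.elim_inr]; split <;> omega
    · rintro (a | ⟨j, z⟩) (b | ⟨j', z'⟩) hab hne
      · simp
      · simp only [Sum.elim_inl, Sum.elim_inr]
        split
        · next h =>
          subst h
          rcases hab with ⟨rfl, rfl⟩ | ⟨rfl, rfl⟩
          · exact absurd rfl hne
          · omega
        · simp
      · simp
      · obtain ⟨rfl, hz⟩ := hab
        have := D3 _ _ hz.symm
        simp only [Sum.elim_inr]
        split <;> omega
  have ht : ∀ i, ∃ f, IsEdgeCert N (fatten H s t Gk x y) (.inl (t i)) (.inr (i, y)) f := by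
    intro i
    refine ⟨Sum.elim (fun _ => 0) (fun p => if p.1 = i then D p.2 else 0), by simp,
      by simp [D1], ?_, ?_⟩
    · rintro (a | ⟨j, z⟩)
      · simp
      · have := D2 z
        simp only [Sum.elim_inr]; split <;> omega
    · rintro (a | ⟨j, z⟩) (b | ⟨j', z'⟩) hab hne
      · simp
      · simp only [Sum.elim_inl, Sum.elim_inr]
        split
        · next h =>
          subst h
          rcases hab with ⟨rfl, rfl⟩ | ⟨rfl, rfl⟩
          · omega
          · exact absurd rfl hne
        · simp
      · simp
      · obtain ⟨rfl, hz⟩ := hab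
        have := D3 _ _ hz
        simp only [Sum.elim_inr]
        split <;> omega
  rintro (u | ⟨i, p⟩) (v | ⟨j, q⟩) huv
  · obtain ⟨f, f0, f1, f2, f3⟩ := hH u v huv
    refine ⟨Sum.elim f (fun p => max (f (s p.1) - D p.2) (f (t p.1) - (N - D p.2))), f0, f1,
      ?_, ?_⟩
    · rintro (a | ⟨j, z⟩)
      · exact f2 a
      · have := f2 (s j)
        have := f2 (t j)
        simp only [Sum.elim_inr]; omega
    · rintro (a | ⟨i, z⟩) (b | ⟨j, z'⟩) hab hne
      · refine f3 a b hab fun h => hne ?_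
        have := congrArg (Sym2.map (Sum.inl : V → V ⊕ ι × K)) h
        simpa using this
      · have := f2 (s j)
        have := f2 (t j)
        simp only [Sum.elim_inl, Sum.elim_inr]
        rcases hab with ⟨rfl, rfl⟩ | ⟨rfl, rfl⟩ <;> omega
      · simp only [Sum.elim_inl, Sum.elim_inr]
        rcases hab with ⟨rfl, rfl⟩ | ⟨rfl, rfl⟩ <;> omega
      · obtain ⟨rfl, hz⟩ := hab
        have := D3 _ _ hz
        have := D3 _ _ hz.symm
        have := D2 z
        have := D2 z'
        simp only [Sum.elim_inr]
        omega
  · rcases huv with ⟨rfl, rfl⟩ | ⟨rfl, rfl⟩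
    · exact hs j
    · exact ht j
  · rcases huv with ⟨rfl, rfl⟩ | ⟨rfl, rfl⟩
    · obtain ⟨f, hf⟩ := hs i
      exact ⟨_, hf.symm⟩
    · obtain ⟨f, hf⟩ := ht i
      exact ⟨_, hf.symm⟩
  · obtain ⟨rfl, hpq⟩ := huv
    obtain ⟨f, ⟨f0, f1, f2, f3⟩, fy, fx⟩ := hg.cert p q hpq
    refine ⟨Sum.elim (fun _ => f x) (fun r => if r.1 = i then f r.2 else f x), by simpa using f0,
      by simpa using f1, ?_, ?_⟩
    · rintro (a | ⟨j, z⟩)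
      · exact f2 x
      · have := f2 z
        have := f2 x
        simp only [Sum.elim_inr]; split <;> omega
    · rintro (a | ⟨j, z⟩) (b | ⟨j', z'⟩) hab hne
      · simp
      · simp only [Sum.elim_inl, Sum.elim_inr]
        rcases hab with ⟨rfl, rfl⟩ | ⟨rfl, rfl⟩ <;> split <;> omega
      · simp only [Sum.elim_inl, Sum.elim_inr]
        rcases hab with ⟨rfl, rfl⟩ | ⟨rfl, rfl⟩ <;> split <;> omega
      · obtain ⟨rfl, hz⟩ := hab
        simp only [Sum.elim_inr]
        split
        · next h =>
          subst h
          refine f3 _ _ hz fun h => hne ?_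
          have := congrArg (Sym2.map (fun z => (Sum.inr (j, z) : V ⊕ ι × K))) h
          simpa using this
        · omega

theorem isLip_fatten {f : V → ℕ} (hf : IsLip H f) (hst : ∀ i, f (s i) = f (t i)) :
    IsLip (fatten H s t Gk x y) (Sum.elim f fun p => f (s p.1)) := by
  rintro (a | ⟨i, z⟩) (b | ⟨j, z'⟩) hab
  · exact hf a b hab
  · have := hst j
    simp only [Sum.elim_inl, Sum.elim_inr]
    rcases hab with ⟨rfl, rfl⟩ | ⟨rfl, rfl⟩ <;> omega
  · have := hst i
    simp only [Sum.elim_inl, Sum.elim_inr]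
    rcases hab with ⟨rfl, rfl⟩ | ⟨rfl, rfl⟩ <;> omega
  · obtain ⟨rfl, -⟩ := hab
    simp

theorem fatten_reachable_inr (hG : Gk.Connected) (i : ι) (z : K) :
    (fatten H s t Gk x y).Reachable (.inl (s i)) (.inr (i, z)) :=
  (Adj.reachable (fatten_inl_inr.2 (.inl ⟨rfl, rfl⟩))).trans
    ((hG.preconnected x z).map
      (⟨fun z => .inr (i, z), fun h => ⟨rfl, h⟩⟩ : Gk →g fatten H s t Gk x y))

theorem fatten_reachable_ends (hG : Gk.Connected) (i : ι) :
    (fatten H s t Gk x y).Reachable (.inl (s i)) (.inl (t i)) :=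
  (fatten_reachable_inr hG i y).trans (Adj.reachable (fatten_inr_inl.2 (.inr ⟨rfl, rfl⟩)))

end fatten

theorem sum_ncard_fiber {V ι : Type*} [Fintype V] [Finite ι] (r : ι → V) :
    ∑ v, {i | r i = v}.ncard = Nat.card ι := by
  classical
  have := Fintype.ofFinite ι
  rw [Nat.card_eq_fintype_card, ← Finset.card_univ,
    Finset.card_eq_sum_card_fiberwise (f := r) (t := Finset.univ) (by simp)]
  refine Finset.sum_congr rfl fun v _ => ?_
  rw [← Set.ncard_coe_finset]
  simp

theorem ncard_sumElim_fiber {V ι κ : Type*} [Finite ι] [Finite κ] (a : ι → V) (b : κ → V)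
    (v : V) : {i | Sum.elim a b i = v}.ncard = {i | a i = v}.ncard + {i | b i = v}.ncard := by
  have h1 : {i | Sum.elim a b i = v} = Sum.inl '' {i | a i = v} ∪ Sum.inr '' {i | b i = v} := by
    ext (i | i) <;> simp
  rw [h1, Set.ncard_union_eq, Set.ncard_image_of_injective _ Sum.inl_injective,
    Set.ncard_image_of_injective _ Sum.inr_injective]
  rw [Set.disjoint_left]
  rintro _ ⟨a, _, rfl⟩ ⟨b, _, hb⟩
  cases hb

section sum

variable {α β : Type*} {G : SimpleGraph α} {H : SimpleGraph β} {N : ℕ}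

theorem isLip_sum {f : α → ℕ} {h : β → ℕ} (hf : IsLip G f) (hh : IsLip H h) :
    IsLip (G.sum H) (Sum.elim f h) := by
  rintro (a | a) (b | b) hab
  · exact hf a b hab
  · simp at hab
  · simp at hab
  · exact hh a b hab

theorem isLip_bot {f : α → ℕ} : IsLip (⊥ : SimpleGraph α) f := fun _ _ h => absurd h (by simp)

theorem girthCert_bot : GirthCert N (⊥ : SimpleGraph α) := fun _ _ h => absurd h (by simp)

theorem girthCert_sum (hG : GirthCert N G) (hH : GirthCert N H) : GirthCert N (G.sum H) := by
  rintro (u | u) (v | v) huv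
  · obtain ⟨f, f0, f1, f2, f3⟩ := hG u v huv
    refine ⟨Sum.elim f fun _ => 0, f0, f1, ?_, ?_⟩
    · rintro (a | a)
      · exact f2 a
      · simp
    · rintro (a | a) (b | b) hab hne
      · refine f3 a b hab fun h => hne ?_
        simpa using congrArg (Sym2.map (Sum.inl : α → α ⊕ β)) h
      · simp at hab
      · simp at hab
      · simp
  · simp at huv
  · simp at huv
  · obtain ⟨f, f0, f1, f2, f3⟩ := hH u v huv
    refine ⟨Sum.elim (fun _ => 0) f, f0, f1, ?_, ?_⟩
    · rintro (a | a)
      · simp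
      · exact f2 a
    · rintro (a | a) (b | b) hab hne
      · simp
      · simp at hab
      · simp at hab
      · refine f3 a b hab fun h => hne ?_
        simpa using congrArg (Sym2.map (Sum.inr : β → α ⊕ β)) h

theorem ncdeg_sum_inl (a : α) : ncdeg (G.sum H) (.inl a) = ncdeg G a := by
  rw [ncdeg, ncdeg, ← Set.ncard_image_of_injective (G.neighborSet a) (Sum.inl_injective (β := β))]
  refine congrArg Set.ncard ?_
  ext (b | b) <;> simp

theorem ncdeg_sum_inr (b : β) : ncdeg (G.sum H) (.inr b) = ncdeg H b := by
  rw [ncdeg, ncdeg, ← Set.ncard_image_of_injective (H.neighborSet b) (Sum.inr_injective (α := α))]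
  refine congrArg Set.ncard ?_
  ext (b | b) <;> simp

theorem ncdeg_bot (a : α) : ncdeg (⊥ : SimpleGraph α) a = 0 := by
  simp [ncdeg]

end sum

theorem exists_pairing {V : Type*} [Fintype V] (e : V → ℕ) (he : Even (∑ v, e v)) :
    ∃ (n : ℕ) (s t : Fin n → V), n ≤ ∑ v, e v ∧
      ∀ v, {i | s i = v}.ncard + {i | t i = v}.ncard = e v := by
  obtain ⟨n, hn⟩ := he
  have hcard : Nat.card (Σ v, Fin (e v)) = Nat.card (Fin n ⊕ Fin n) := by
    simp [hn]
  let φ : (Σ v, Fin (e v)) ≃ Fin n ⊕ Fin n :=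
    ((Finite.equivFinOfCardEq hcard).trans (Finite.equivFin _).symm)
  refine ⟨n, fun i => (φ.symm (.inl i)).1, fun i => (φ.symm (.inr i)).1, by omega, fun v => ?_⟩
  have h : φ '' Set.range (Sigma.mk v) = Sum.inl '' {i | (φ.symm (.inl i)).1 = v} ∪
      Sum.inr '' {i | (φ.symm (.inr i)).1 = v} := by
    ext p
    have hp : p ∈ φ '' Set.range (Sigma.mk v) ↔ (φ.symm p).1 = v := by
      rw [Equiv.image_eq_preimage_symm]
      constructor
      · rintro ⟨q, hq⟩
        rw [← hq]
      · intro hv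
        refine ⟨hv ▸ (φ.symm p).2, ?_⟩
        subst hv
        rfl
    rw [hp]
    cases p <;> simp
  have hd : Disjoint (Sum.inl '' {i | (φ.symm (.inl i)).1 = v} : Set (Fin n ⊕ Fin n))
      (Sum.inr '' {i | (φ.symm (.inr i)).1 = v}) := by
    rw [Set.disjoint_left]
    rintro _ ⟨a, _, rfl⟩ ⟨b, _, hb⟩
    cases hb
  rw [← Set.ncard_image_of_injective _ (Sum.inl_injective (β := Fin n)),
    ← Set.ncard_image_of_injective {i | (φ.symm (.inr i)).1 = v} (Sum.inr_injective (α := Fin n)),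
    ← Set.ncard_union_eq hd, ← h, Set.ncard_image_of_injective _ φ.injective, ← Set.image_univ,
    Set.ncard_image_of_injective _ sigma_mk_injective, Set.ncard_univ, Nat.card_fin]

/-- `H'` is obtained from `H` by raising the degree of every vertex `v` by `d v`, keeping the
girth large and adding only vertices of degree `k`. -/
structure IsCompletion (k N M : ℕ) {V U : Type*} [Fintype V] (H : SimpleGraph V) (d : V → ℕ)
    (H' : SimpleGraph U) (j : V → U) : Prop where
  inj : Function.Injective j
  adj : ∀ a b, H.Adj a b → H'.Adj (j a) (j b)
  deg : ∀ v, ncdeg H' (j v) = ncdeg H v + d v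
  deg_new : ∀ u, u ∉ Set.range j → ncdeg H' u = k
  cert : GirthCert N H'
  reach : ∀ z, ∃ v, H'.Reachable (j v) z
  lip : ∀ (f : V → ℕ) (c : ℕ), IsLip H f → (∀ v, 0 < d v → f v = c) →
    ∃ f' : U → ℕ, IsLip H' f' ∧ ∀ v, f' (j v) = f v
  card : Nat.card U ≤ Nat.card V + (∑ v, d v + k) * M + 1

theorem IsCompletion.reachable {k N M : ℕ} {V U : Type*} [Fintype V] {H : SimpleGraph V}
    {d : V → ℕ} {H' : SimpleGraph U} {j : V → U} (h : IsCompletion k N M H d H' j) {a b : V}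
    (hab : H.Reachable a b) : H'.Reachable (j a) (j b) :=
  hab.map (⟨j, fun h' => h.adj _ _ h'⟩ : H →g H')

theorem exists_completion_of_even (k N : ℕ) (hk : 3 ≤ k) :
    ∃ M : ℕ, ∀ (V : Type u) [Fintype V] (H : SimpleGraph V) (d : V → ℕ) (ι : Type) [Finite ι]
      (s t : ι → V), GirthCert N H → Even (∑ v, d v) →
      (∀ v, {i | s i = v}.ncard + {i | t i = v}.ncard ≤ d v) →
      ∃ (U : Type u) (_ : Finite U) (H' : SimpleGraph U) (j : V → U),
        IsCompletion k N M H d H' j ∧ (∀ i, H'.Reachable (j (s i)) (j (t i))) ∧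
        Nat.card U ≤ Nat.card V + (∑ v, d v) * M := by
  classical
  obtain ⟨K, hK, Gk, x, y, hg⟩ := exists_gadget k N hk
  refine ⟨Nat.card K, fun V _ H d ι _ s t hH he hst => ?_⟩
  let e : V → ℕ := fun v => d v - ({i | s i = v}.ncard + {i | t i = v}.ncard)
  have hsum : ∑ v, e v + (Nat.card ι + Nat.card ι) = ∑ v, d v := by
    rw [← sum_ncard_fiber s]
    nth_rewrite 2 [sum_ncard_fiber s]
    rw [← sum_ncard_fiber t, ← Finset.sum_add_distrib, ← Finset.sum_add_distrib]
    refine Finset.sum_congr rfl fun v _ => ?_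
    have := hst v
    simp only [e]
    omega
  have hee : Even (∑ v, e v) := by
    rw [← hsum, Nat.even_add] at he
    exact he.2 ⟨_, rfl⟩
  obtain ⟨n, s', t', hn, hst'⟩ := exists_pairing e hee
  let S : ι ⊕ Fin n → V := Sum.elim s s'
  let T : ι ⊕ Fin n → V := Sum.elim t t'
  have hST : ∀ v, {i | S i = v}.ncard + {i | T i = v}.ncard = d v := by
    intro v
    have h1 := hst v
    have h2 := hst' v
    simp only [S, T, ncard_sumElim_fiber]
    simp only [e] at h2
    omega
  have hSd : ∀ i, 0 < d (S i) := fun i => by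
    have : 0 < {i' | S i' = S i}.ncard := (Set.ncard_pos (Set.toFinite _)).2 ⟨i, rfl⟩
    have := hST (S i)
    omega
  have hTd : ∀ i, 0 < d (T i) := fun i => by
    have : 0 < {i' | T i' = T i}.ncard := (Set.ncard_pos (Set.toFinite _)).2 ⟨i, rfl⟩
    have := hST (T i)
    omega
  have hcard : Nat.card (V ⊕ (ι ⊕ Fin n) × K) ≤ Nat.card V + (∑ v, d v) * Nat.card K := by
    rw [Nat.card_sum, Nat.card_prod, Nat.card_sum, Nat.card_fin]
    gcongr
    omega
  refine ⟨V ⊕ (ι ⊕ Fin n) × K, inferInstance, fatten H S T Gk x y, Sum.inl,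
    ⟨Sum.inl_injective, fun _ _ h => h, fun v => ?_, ?_, girthCert_fatten hg hH, ?_, ?_, ?_⟩,
    fun i => fatten_reachable_ends (s := S) (t := T) hg.conn (.inl i), hcard⟩
  · rw [ncdeg_fatten_inl hg.ne, ← hST v, add_assoc]
  · rintro (a | ⟨i, z⟩) h
    · exact absurd ⟨a, rfl⟩ h
    · exact ncdeg_fatten_inr hg i z
  · rintro (a | ⟨i, z⟩)
    · exact ⟨a, .rfl⟩
    · exact ⟨S i, fatten_reachable_inr hg.conn i z⟩
  · intro f c hf hc
    exact ⟨_, isLip_fatten hf fun i => by rw [hc _ (hSd i), hc _ (hTd i)], fun _ => rfl⟩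
  · refine hcard.trans ?_
    rw [add_mul]
    omega

theorem exists_completion (k N : ℕ) (hk : 3 ≤ k) :
    ∃ M : ℕ, ∀ (V : Type u) [Fintype V] (H : SimpleGraph V) (d : V → ℕ) (ι : Type) [Finite ι]
      (s t : ι → V), GirthCert N H → (Even k → Even (∑ v, d v)) →
      (∀ v, {i | s i = v}.ncard + {i | t i = v}.ncard ≤ d v) →
      ∃ (U : Type u) (_ : Finite U) (H' : SimpleGraph U) (j : V → U),
        IsCompletion k N M H d H' j ∧ ∀ i, H'.Reachable (j (s i)) (j (t i)) := by
  classical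
  obtain ⟨M, hM⟩ := exists_completion_of_even k N hk
  refine ⟨M, fun V _ H d ι _ s t hH he hst => ?_⟩
  by_cases hd : Even (∑ v, d v)
  · obtain ⟨U, hU, H', j, h, hr, -⟩ := hM V H d ι s t hH hd hst
    exact ⟨U, hU, H', j, h, hr⟩
  have hko : ¬ Even k := fun h => hd (he h)
  have hleft : ∃ v, {i | s i = v}.ncard + {i | t i = v}.ncard < d v := by
    by_contra! hall
    have h1 : ∑ v, d v = ∑ v, {i | s i = v}.ncard + ∑ v, {i | t i = v}.ncard := by
      rw [← Finset.sum_add_distrib]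
      exact Finset.sum_congr rfl fun v _ => le_antisymm (hall v) (hst v)
    rw [sum_ncard_fiber, sum_ncard_fiber] at h1
    exact hd ⟨_, h1⟩
  obtain ⟨v₀, hv₀⟩ := hleft
  obtain ⟨U, hU, H', j, h, hr, hc⟩ := hM (V ⊕ PUnit.{u + 1}) (H.sum ⊥)
    (Sum.elim d fun _ => k) (ι ⊕ Unit) (Sum.elim (fun i => .inl (s i)) fun _ => .inl v₀)
    (Sum.elim (fun i => .inl (t i)) fun _ => .inr ⟨⟩) (girthCert_sum hH girthCert_bot)
    (by
      rw [Fintype.sum_sum_type]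
      simp only [Sum.elim_inl, Sum.elim_inr, Finset.univ_unique, Finset.sum_const,
        Finset.card_singleton, one_smul]
      rw [Nat.even_add]
      exact ⟨fun h => absurd h hd, fun h => absurd h hko⟩)
    (by
      rintro (v | v)
      · rw [ncard_sumElim_fiber, ncard_sumElim_fiber]
        have h1 := hst v
        simp only [Sum.inl.injEq, reduceCtorEq, Set.ofPred_false, Set.ncard_empty,
          Sum.elim_inl]
        by_cases hv : v₀ = v
        · subst hv
          simp
          omega
        · simp [hv]
          omega
      · rw [ncard_sumElim_fiber, ncard_sumElim_fiber]
        simp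
        omega)
  refine ⟨U, hU, H', fun v => j (.inl v), ⟨h.inj.comp Sum.inl_injective,
    fun a b hab => h.adj (.inl a) (.inl b) hab, fun v => ?_, fun u hu => ?_, h.cert, fun z => ?_,
    fun f c hf hfc => ?_, ?_⟩, fun i => hr (.inl i)⟩
  · rw [h.deg (.inl v), ncdeg_sum_inl]
    rfl
  · by_cases hu' : u = j (.inr ⟨⟩)
    · rw [hu', h.deg (.inr ⟨⟩), ncdeg_sum_inr, ncdeg_bot, zero_add]
      rfl
    · refine h.deg_new u ?_
      rintro ⟨v | v, rfl⟩
      · exact hu ⟨v, rfl⟩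
      · exact hu' rfl
  · obtain ⟨v | v, hv⟩ := h.reach z
    · exact ⟨v, hv⟩
    · exact ⟨v₀, (hr (.inr ())).trans hv⟩
  · obtain ⟨f', hf', h1⟩ := h.lip (Sum.elim f fun _ => c) c (isLip_sum hf isLip_bot) (by
      rintro (v | v) hv
      · exact hfc v hv
      · rfl)
    exact ⟨f', hf', fun v => h1 (.inl v)⟩
  · refine hc.trans (le_of_eq ?_)
    simp [Fintype.sum_sum_type]
    ring

theorem girthCert_cycleGraph {N n : ℕ} (hN : N ≤ n + 2) : GirthCert N (cycleGraph (n + 3)) := by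
  have key : ∀ u v : Fin (n + 3), v - u = 1 →
      ∃ f, IsEdgeCert N (cycleGraph (n + 3)) u v f := by
    intro u v huv
    have hv : v = u + 1 := by rw [← huv]; abel
    subst hv
    refine ⟨fun a => min N (u - a).val, by simp, ?_, fun a => min_le_left _ _, ?_⟩
    · have : u - (u + 1) = -1 := by abel
      simp only [this, Fin.coe_neg_one]
      omega
    · intro a b hab hne
      have hstep : ∀ c : Fin (n + 3), c ≠ u → (u - (c + 1)).val + 1 = (u - c).val := by
        intro c hc
        have h1 : u - c ≠ 0 := fun h => hc (sub_eq_zero.1 h).symm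
        have h2 := Fin.val_sub_one_of_ne_zero h1
        have h3 : u - (c + 1) = u - c - 1 := by abel
        have h4 : (u - c).val ≠ 0 := fun h => h1 (Fin.ext h)
        rw [h3, h2]
        omega
      rcases cycleGraph_adj.1 hab with h | h
      · obtain rfl : a = b + 1 := by rw [← h]; abel
        have := hstep b (fun hb => hne (by rw [hb, Sym2.eq_swap]))
        dsimp only
        omega
      · obtain rfl : b = a + 1 := by rw [← h]; abel
        have := hstep a (fun hb => hne (by rw [hb]))
        dsimp only
        omega
  intro u v huv
  rcases cycleGraph_adj.1 huv with h | h
  · obtain ⟨f, hf⟩ := key v u h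
    exact ⟨_, hf.symm⟩
  · exact key u v h

theorem ncdeg_cycleGraph {n : ℕ} (v : Fin (n + 3)) : ncdeg (cycleGraph (n + 3)) v = 2 := by
  rw [← cycleGraph_degree_three_le (v := v), ncdeg, ← card_neighborFinset_eq_degree,
    ← Set.ncard_coe_finset, coe_neighborFinset]

theorem dist_cycleGraph_le {m t : ℕ} (ht : m + 3 = 2 * t) (a b : Fin (m + 3)) :
    (cycleGraph (m + 3)).dist a b ≤ t := by
  have key : ∀ (i : ℕ) (a b : Fin (m + 3)), (b - a).val = i →
      (cycleGraph (m + 3)).dist a b ≤ i := by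
    intro i
    induction i with
    | zero =>
      intro a b h
      have : b - a = 0 := Fin.ext h
      rw [sub_eq_zero.1 this, dist_self]
    | succ i ih =>
      intro a b h
      have h0 : b - a ≠ 0 := fun h' => by rw [h'] at h; simp at h
      have h1 := Fin.val_sub_one_of_ne_zero h0
      have h2 : b - 1 - a = b - a - 1 := by abel
      have h3 := ih a (b - 1) (by rw [h2, h1]; omega)
      have hadj : (cycleGraph (m + 3)).Adj (b - 1) b := cycleGraph_adj.2 (.inr (by abel))
      refine (cycleGraph_connected (n := m + 2)).dist_triangle.trans (Nat.add_le_add h3 ?_)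
      rw [dist_eq_one_iff_adj.2 hadj]
  have h1 := key _ a b rfl
  have h2 := key _ b a rfl
  rw [dist_comm] at h2
  by_cases hab : a = b
  · subst hab; simp
  have h3 : (a - b).val = (m + 3) - (b - a).val := by
    rw [← neg_sub b a, Fin.val_neg]
    have : b - a ≠ 0 := fun h => hab (sub_eq_zero.1 h).symm
    simp [this]
  omega

theorem le_dist_cycleGraph {m t : ℕ} (ht : m + 3 = 2 * t) :
    t ≤ (cycleGraph (m + 3)).dist 0 ⟨t, by omega⟩ := by
  have hlip : IsLip (cycleGraph (m + 3)) (fun a => min a.val (m + 3 - a.val)) := by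
    have key : ∀ a b : Fin (m + 3), b - a = 1 →
        (b.val = a.val + 1 ∨ (b.val = 0 ∧ a.val = m + 2)) := by
      intro a b h
      obtain rfl : b = a + 1 := by rw [← h]; abel
      rw [Fin.val_add_one]
      by_cases ha : a = Fin.last (m + 2)
      · simp [ha]
      · simp [ha]
    intro a b hab
    rcases cycleGraph_adj.1 hab with h | h
    · have := key _ _ h
      dsimp only; omega
    · have := key _ _ h
      dsimp only; omega
  have := hlip.le_add_dist (cycleGraph_connected (n := m + 2)) 0 ⟨t, by omega⟩
  simp only [Fin.val_zero] at this
  omega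

/-- A connected graph of girth greater than `N` whose vertices have degree `k`, except for the
root `w` of degree `k - 2`. -/
structure IsRooted (k N : ℕ) {W : Type*} (G : SimpleGraph W) (w : W) : Prop where
  conn : G.Connected
  deg_root : ncdeg G w + 2 = k
  deg : ∀ z, z ≠ w → ncdeg G z = k
  cert : GirthCert N G
  cyc : cycleGraph (N + 1) ⊑ G

theorem ncard_unit_fiber {V : Type*} [DecidableEq V] (a v : V) :
    {i : Unit | (fun _ => a) i = v}.ncard = if a = v then 1 else 0 := by
  split <;> simp [*]

theorem exists_isRooted (k N : ℕ) (hk : 3 ≤ k) (hN : 2 ≤ N) :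
    ∃ (W : Type u) (_ : Finite W) (G : SimpleGraph W) (w : W), IsRooted k N G w := by
  classical
  obtain ⟨n, rfl⟩ : ∃ n, N = n + 2 := ⟨N - 2, by omega⟩
  obtain ⟨M, hM⟩ := exists_completion.{u} k (n + 2) hk
  obtain ⟨U, hU, H', j, h, hr⟩ := hM (Fin (n + 3) ⊕ PUnit.{u + 1}) ((cycleGraph (n + 3)).sum ⊥)
    (fun _ => k - 2) Unit (fun _ => .inr ⟨⟩) (fun _ => .inl 0)
    (girthCert_sum (girthCert_cycleGraph le_rfl) girthCert_bot)
    (fun hk => by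
      rw [Finset.sum_const]
      exact Even.mul_left (Even.tsub hk even_two) _)
    (by
      rintro (v | v) <;> rw [ncard_unit_fiber, ncard_unit_fiber]
      · simp only [reduceCtorEq, if_false]; split <;> omega
      · simp only [reduceCtorEq, if_false]; split <;> omega)
  have hcy : ∀ v, H'.Reachable (j (.inr ⟨⟩)) (j (.inl v)) := fun v =>
    (hr ()).trans (h.reachable ((cycleGraph_connected (n := n + 2)).preconnected 0 v |>.map
      (⟨Sum.inl, fun h => h⟩ : cycleGraph (n + 3) →g (cycleGraph (n + 3)).sum _)))
  have hall : ∀ z, H'.Reachable (j (.inr ⟨⟩)) z := by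
    intro z
    obtain ⟨v | v, hv⟩ := h.reach z
    · exact (hcy v).trans hv
    · exact hv
  refine ⟨U, hU, H', j (.inr ⟨⟩), ?_, ?_, ?_, h.cert, ?_⟩
  · have : Nonempty U := ⟨j (.inr ⟨⟩)⟩
    exact ⟨fun a b => (hall a).symm.trans (hall b)⟩
  · rw [h.deg, ncdeg_sum_inr, ncdeg_bot]
    omega
  · intro z hz
    by_cases hzj : z ∈ Set.range j
    · obtain ⟨v | v, rfl⟩ := hzj
      · rw [h.deg, ncdeg_sum_inl, ncdeg_cycleGraph]
        omega
      · exact absurd rfl hz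
    · exact h.deg_new z hzj
  · exact ⟨⟨⟨fun v => j (.inl v), fun {a b} hab => h.adj _ _ (sum_adj_inl.2 hab)⟩,
      h.inj.comp Sum.inl_injective⟩⟩

theorem isLip_dist {V : Type*} {G : SimpleGraph V} (hG : G.Connected) (a : V) :
    IsLip G (G.dist a) := by
  intro b c h
  refine (hG.dist_triangle (v := b)).trans ?_
  rw [dist_eq_one_iff_adj.2 h]

theorem dist_map_le {V W : Type*} {G : SimpleGraph V} {H : SimpleGraph W} (hG : G.Connected)
    (f : G →g H) (a b : V) : H.dist (f a) (f b) ≤ G.dist a b := by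
  obtain ⟨p, hp⟩ := hG.exists_walk_length_eq_dist a b
  rw [← hp, ← Walk.length_map f p]
  exact dist_le _

/-- Identify the root `y` of `Y` with the vertex `o` of the base `B`, and the root of a copy of
`W` with every other vertex of `B`. -/
def hang {I α β : Type*} (B : SimpleGraph I) (o : I) (Y : SimpleGraph α) (y : α)
    (W : SimpleGraph β) (w : β) : SimpleGraph (α ⊕ {i // i ≠ o} × β) where
  Adj
    | .inl a, .inl b => Y.Adj a b
    | .inl a, .inr (i, z) => a = y ∧ z = w ∧ B.Adj o i
    | .inr (i, z), .inl a => a = y ∧ z = w ∧ B.Adj o i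
    | .inr (i, z), .inr (j, z') => (i = j ∧ W.Adj z z') ∨ (z = w ∧ z' = w ∧ B.Adj i j)
  symm := ⟨by
    rintro (a | ⟨i, z⟩) (b | ⟨j, z'⟩) h
    · exact Y.adj_symm h
    · exact h
    · exact h
    · rcases h with ⟨h1, h2⟩ | ⟨h1, h2, h3⟩
      · exact .inl ⟨h1.symm, h2.symm⟩
      · exact .inr ⟨h2, h1, h3.symm⟩⟩
  loopless := ⟨by
    rintro (a | ⟨i, z⟩) h
    · exact Y.loopless.irrefl a h
    · rcases h with ⟨_, h⟩ | ⟨_, _, h⟩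
      · exact W.loopless.irrefl z h
      · exact B.loopless.irrefl i h⟩

section hang

variable {I α β : Type*} {B : SimpleGraph I} {o : I} {Y : SimpleGraph α} {y : α}
  {W : SimpleGraph β} {w : β}

theorem hang_inl_inl {a b : α} : (hang B o Y y W w).Adj (.inl a) (.inl b) ↔ Y.Adj a b := Iff.rfl

theorem hang_inl_inr {a : α} {i : {i // i ≠ o}} {z : β} :
    (hang B o Y y W w).Adj (.inl a) (.inr (i, z)) ↔ a = y ∧ z = w ∧ B.Adj o i := Iff.rfl

theorem hang_inr_inl {a : α} {i : {i // i ≠ o}} {z : β} :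
    (hang B o Y y W w).Adj (.inr (i, z)) (.inl a) ↔ a = y ∧ z = w ∧ B.Adj o i := Iff.rfl

theorem hang_inr_inr {i j : {i // i ≠ o}} {z z' : β} :
    (hang B o Y y W w).Adj (.inr (i, z)) (.inr (j, z')) ↔
      (i = j ∧ W.Adj z z') ∨ (z = w ∧ z' = w ∧ B.Adj i j) := Iff.rfl

theorem ncdeg_hang_inl_of_ne {a : α} (ha : a ≠ y) :
    ncdeg (hang B o Y y W w) (.inl a) = ncdeg Y a := by
  rw [ncdeg, ncdeg, ← Set.ncard_image_of_injective (Y.neighborSet a) Sum.inl_injective]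
  congr 1
  ext (b | ⟨i, z⟩)
  · simp [hang_inl_inl]
  · simp [hang_inl_inr, ha]

theorem ncdeg_hang_inr_of_ne {i : {i // i ≠ o}} {z : β} (hz : z ≠ w) :
    ncdeg (hang B o Y y W w) (.inr (i, z)) = ncdeg W z := by
  have hinj : Function.Injective fun z' : β => (.inr (i, z') : α ⊕ {i // i ≠ o} × β) :=
    fun a b h => by simpa using h
  rw [ncdeg, ncdeg, ← Set.ncard_image_of_injective (W.neighborSet z) hinj]
  congr 1
  ext (b | ⟨j, z'⟩)
  · simp [hang_inr_inl, hz]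
  · simp [hang_inr_inr, hz, eq_comm, and_comm]

theorem ncdeg_hang_inl_root [Finite I] [Finite α] [Finite β] :
    ncdeg (hang B o Y y W w) (.inl y) = ncdeg Y y + ncdeg B o := by
  have hinj : Function.Injective fun i : {i // i ≠ o} =>
      (.inr (i, w) : α ⊕ {i // i ≠ o} × β) := fun a b h => by simpa using h
  have hB : ncdeg B o = (Subtype.val ⁻¹' B.neighborSet o : Set {i // i ≠ o}).ncard := by
    rw [ncdeg, ← Set.ncard_image_of_injective _ Subtype.val_injective]
    congr 1
    ext i
    constructor
    · intro h
      exact ⟨⟨i, h.ne'⟩, h, rfl⟩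
    · rintro ⟨j, h, rfl⟩
      exact h
  rw [hB, ncdeg, ncdeg, ← Set.ncard_image_of_injective (Y.neighborSet y)
    (Sum.inl_injective (β := {i // i ≠ o} × β)), ← Set.ncard_image_of_injective _ hinj,
    ← Set.ncard_union_eq]
  · congr 1
    ext (b | ⟨j, z'⟩)
    · simp [hang_inl_inl]
    · simp only [mem_neighborSet, hang_inl_inr]
      simp [eq_comm, and_comm]
  · rw [Set.disjoint_left]
    rintro _ ⟨a, _, rfl⟩ ⟨b, _, hb⟩
    cases hb

theorem ncdeg_hang_inr_root [Finite I] [Finite α] [Finite β] (i : {i // i ≠ o}) :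
    ncdeg (hang B o Y y W w) (.inr (i, w)) = ncdeg W w + ncdeg B i := by
  classical
  have hinj : Function.Injective fun z' : β => (.inr (i, z') : α ⊕ {i // i ≠ o} × β) :=
    fun a b h => by simpa using h
  let σ : I → α ⊕ {i // i ≠ o} × β := fun j => if h : j = o then .inl y else .inr (⟨j, h⟩, w)
  have hσ : Function.Injective σ := by
    intro a b h
    by_cases ha : a = o <;> by_cases hb : b = o <;> simp [σ, ha, hb] at h
    · rw [ha, hb]
    · exact h
  rw [ncdeg, ncdeg, ncdeg, ← Set.ncard_image_of_injective (W.neighborSet w) hinj,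
    ← Set.ncard_image_of_injective (B.neighborSet i) hσ, ← Set.ncard_union_eq]
  · congr 1
    ext (b | ⟨j, z'⟩)
    · simp only [mem_neighborSet, hang_inr_inl, Set.mem_union, Set.mem_image]
      constructor
      · rintro ⟨rfl, -, h⟩
        exact .inr ⟨o, h.symm, by simp [σ]⟩
      · rintro (⟨_, _, h⟩ | ⟨j, hj, h⟩)
        · cases h
        · by_cases hjo : j = o
          · subst hjo
            simp [σ] at h
            exact ⟨h.symm, trivial, hj.symm⟩
          · simp [σ, hjo] at h
    · simp only [mem_neighborSet, hang_inr_inr, Set.mem_union, Set.mem_image]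
      constructor
      · rintro (⟨rfl, h⟩ | ⟨-, rfl, h⟩)
        · exact .inl ⟨z', h, rfl⟩
        · exact .inr ⟨j, h, by simp [σ, j.2]⟩
      · rintro (⟨_, h', h⟩ | ⟨j', hj, h⟩)
        · simp at h
          obtain ⟨rfl, rfl⟩ := h
          exact .inl ⟨rfl, h'⟩
        · by_cases hjo : j' = o
          · simp [σ, hjo] at h
          · simp [σ, hjo] at h
            obtain ⟨rfl, rfl⟩ := h
            exact .inr ⟨trivial, rfl, hj⟩
  · rw [Set.disjoint_left]
    rintro _ ⟨a, ha, rfl⟩ ⟨b, _, hb⟩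
    by_cases hbo : b = o
    · simp [σ, hbo] at hb
    · simp [σ, hbo] at hb
      rw [← hb.2] at ha
      exact W.loopless.irrefl _ ha

theorem girthCert_hang {N : ℕ} (hB : GirthCert N B) (hY : GirthCert N Y) (hW : GirthCert N W) :
    GirthCert N (hang B o Y y W w) := by
  classical
  have hbase : ∀ (u v : α ⊕ {i // i ≠ o} × β) (π : α ⊕ {i // i ≠ o} × β → I),
      (∀ p, π p = Sum.elim (fun _ => o) (fun q => q.1.1) p) → B.Adj (π u) (π v) →
      u = (if h : π u = o then .inl y else .inr (⟨π u, h⟩, w)) → 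
      v = (if h : π v = o then .inl y else .inr (⟨π v, h⟩, w)) → 
      ∃ f, IsEdgeCert N (hang B o Y y W w) u v f := by
    intro u v π hπ huv hu hv
    obtain ⟨f, f0, f1, f2, f3⟩ := hB _ _ huv
    refine ⟨fun p => f (π p), f0, f1, fun p => f2 _, ?_⟩
    have key : ∀ a b, π a = π b ∨ (B.Adj (π a) (π b) ∧
      a = (if h : π a = o then .inl y else .inr (⟨π a, h⟩, w)) ∧
      b = (if h : π b = o then .inl y else .inr (⟨π b, h⟩, w))) → s(a, b) ≠ s(u, v) →
      f (π b) ≤ f (π a) + 1 := by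
      rintro a b (h | ⟨h, ha, hb⟩) hne
      · rw [h]; omega
      · refine f3 _ _ h fun h' => hne ?_
        rcases Sym2.eq_iff.1 h' with ⟨h1, h2⟩ | ⟨h1, h2⟩
        · simp only [h1] at ha
          simp only [h2] at hb
          rw [ha, hb, ← hu, ← hv]
        · simp only [h1] at ha
          simp only [h2] at hb
          rw [ha, hb, ← hu, ← hv, Sym2.eq_swap]
    intro a b hab hne
    refine key a b ?_ hne
    obtain rfl : π = Sum.elim (fun _ => o) (fun q => q.1.1) := funext hπ
    rcases a with a | ⟨i, z⟩ <;> rcases b with b | ⟨j, z'⟩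
    · exact .inl rfl
    · obtain ⟨rfl, rfl, h⟩ := hab
      exact .inr ⟨h, by simp, by simp [j.2]⟩
    · obtain ⟨rfl, rfl, h⟩ := hab
      exact .inr ⟨h.symm, by simp [i.2], by simp⟩
    · rcases hab with ⟨rfl, h⟩ | ⟨rfl, rfl, h⟩
      · exact .inl rfl
      · exact .inr ⟨h, by simp [i.2], by simp [j.2]⟩
  rintro (u | ⟨i, z⟩) (v | ⟨j, z'⟩) huv
  · obtain ⟨f, f0, f1, f2, f3⟩ := hY u v huv
    refine ⟨Sum.elim f fun _ => f y, f0, f1, ?_, ?_⟩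
    · rintro (a | ⟨i, z⟩)
      · exact f2 a
      · exact f2 y
    · rintro (a | ⟨i, z⟩) (b | ⟨j, z'⟩) hab hne
      · refine f3 a b hab fun h => hne ?_
        simpa using congrArg (Sym2.map (Sum.inl : α → α ⊕ {i // i ≠ o} × β)) h
      · obtain ⟨rfl, rfl, h⟩ := hab
        simp
      · obtain ⟨rfl, rfl, h⟩ := hab
        simp
      · simp
  · obtain ⟨rfl, rfl, h⟩ := huv
    exact hbase _ _ _ (fun _ => rfl) h (by simp) (by simp [j.2])
  · obtain ⟨rfl, rfl, h⟩ := huv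
    exact hbase _ _ _ (fun _ => rfl) h.symm (by simp [i.2]) (by simp)
  · rcases huv with ⟨rfl, h⟩ | ⟨rfl, rfl, h⟩
    · obtain ⟨f, f0, f1, f2, f3⟩ := hW z z' h
      refine ⟨Sum.elim (fun _ => f w) fun q => if q.1 = i then f q.2 else f w, by simpa using f0,
        by simpa using f1, ?_, ?_⟩
      · rintro (a | ⟨j, z⟩)
        · exact f2 w
        · have := f2 z
          have := f2 w
          simp only [Sum.elim_inr]; split <;> omega
      · rintro (a | ⟨j, p⟩) (b | ⟨j', q⟩) hab hne
        · simp
        · obtain ⟨rfl, rfl, h⟩ := hab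
          simp
        · obtain ⟨rfl, rfl, h⟩ := hab
          simp
        · rcases hab with ⟨rfl, h⟩ | ⟨rfl, rfl, h⟩
          · simp only [Sum.elim_inr]
            split
            · next hj =>
              subst hj
              refine f3 _ _ h fun h => hne ?_
              simpa using congrArg (Sym2.map (fun z => (.inr (j, z) : α ⊕ {i // i ≠ o} × β))) h
            · omega
          · simp
    · exact hbase _ _ _ (fun _ => rfl) h (by simp [i.2]) (by simp [j.2])

theorem hang_hom_base [DecidableEq I] : ∃ f : B →g hang B o Y y W w,
    f o = .inl y ∧ ∀ i : {i // i ≠ o}, f i = .inr (i, w) := by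
  refine ⟨⟨fun j => if h : j = o then .inl y else .inr (⟨j, h⟩, w), ?_⟩, by simp, 
    fun i => by simp [i.2]⟩
  intro a b hab
  by_cases ha : a = o
  · by_cases hb : b = o
    · rw [ha, hb] at hab
      exact absurd hab (B.loopless.irrefl o)
    · subst ha
      simp only [hb]
      simpa [hang_inl_inr] using hab
  · by_cases hb : b = o
    · subst hb
      simp only [ha]
      simpa [hang_inr_inl] using hab.symm
    · simp only [ha, hb]
      exact hang_inr_inr.2 (.inr ⟨rfl, rfl, hab⟩)

/-- The inclusion of the graph hung at the vertex `o`. -/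
def hangInl : Y →g hang B o Y y W w := ⟨Sum.inl, fun h => h⟩

/-- The inclusion of the graph hung at the vertex `i`. -/
def hangInr (i : {i // i ≠ o}) : W →g hang B o Y y W w :=
  ⟨fun z => .inr (i, z), fun h => .inl ⟨rfl, h⟩⟩

theorem hang_connected (hB : B.Connected) (hY : Y.Connected) (hW : W.Connected) :
    (hang B o Y y W w).Connected := by
  classical
  have h : ∀ p, (hang B o Y y W w).Reachable (.inl y) p := by
    rintro (a | ⟨i, z⟩)
    · exact (hY.preconnected y a).map hangInl
    · obtain ⟨f, f0, f1⟩ := hang_hom_base (B := B) (o := o) (Y := Y) (y := y) (W := W) (w := w)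
      have h1 := (hB.preconnected o i).map f
      rw [f0, f1] at h1
      exact h1.trans ((hW.preconnected w z).map (hangInr i))
  have : Nonempty (α ⊕ {i // i ≠ o} × β) := ⟨.inl y⟩
  exact ⟨fun a b => (h a).symm.trans (h b)⟩

theorem dist_hang_inl_inl_le (hY : Y.Connected) (a b : α) :
    (hang B o Y y W w).dist (.inl a) (.inl b) ≤ Y.dist a b :=
  dist_map_le hY hangInl a b

theorem dist_hang_inr_inr_le (hB : B.Connected) (hY : Y.Connected) (hW : W.Connected)
    (i j : {i // i ≠ o}) (z z' : β) :
    (hang B o Y y W w).dist (.inr (i, z)) (.inr (j, z')) ≤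
      W.dist z w + B.dist i j + W.dist w z' := by
  classical
  have hc := hang_connected (o := o) (y := y) (w := w) hB hY hW
  obtain ⟨f, f0, f1⟩ := hang_hom_base (B := B) (o := o) (Y := Y) (y := y) (W := W) (w := w)
  have h1 := dist_map_le hB f i j
  rw [f1, f1] at h1
  have h2 : (hang B o Y y W w).dist (.inr (i, z)) (.inr (i, w)) ≤ _ :=
    dist_map_le hW (hangInr i) z w
  have h3 : (hang B o Y y W w).dist (.inr (j, w)) (.inr (j, z')) ≤ _ :=
    dist_map_le hW (hangInr j) w z'
  exact (hc.dist_triangle (v := .inr (j, w))).trans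
    (Nat.add_le_add ((hc.dist_triangle (v := .inr (i, w))).trans (Nat.add_le_add h2 h1)) h3)

theorem dist_hang_inl_inr (hB : B.Connected) (hY : Y.Connected) (hW : W.Connected)
    (a : α) (i : {i // i ≠ o}) (z : β) :
    (hang B o Y y W w).dist (.inl a) (.inr (i, z)) =
      Y.dist a y + B.dist o i + W.dist w z := by
  classical
  have hc := hang_connected (o := o) (y := y) (w := w) hB hY hW
  refine le_antisymm ?_ ?_
  · obtain ⟨f, f0, f1⟩ := hang_hom_base (B := B) (o := o) (Y := Y) (y := y) (W := W) (w := w)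
    have h1 := dist_map_le hB f o i
    rw [f0, f1] at h1
    have h2 : (hang B o Y y W w).dist (.inl a) (.inl y) ≤ _ := dist_map_le hY hangInl a y
    have h3 : (hang B o Y y W w).dist (.inr (i, w)) (.inr (i, z)) ≤ _ :=
      dist_map_le hW (hangInr i) w z
    exact (hc.dist_triangle (v := .inr (i, w))).trans
      (Nat.add_le_add ((hc.dist_triangle (v := .inl y)).trans (Nat.add_le_add h2 h1)) h3)
  · have hlip : IsLip (hang B o Y y W w) (Sum.elim (Y.dist a)
        fun q => Y.dist a y + B.dist o q.1 + W.dist w q.2) := by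
      rintro (b | ⟨j, p⟩) (c | ⟨j', q⟩) h
      · exact isLip_dist hY a _ _ h
      · obtain ⟨rfl, rfl, h⟩ := h
        simp only [Sum.elim_inl, Sum.elim_inr, SimpleGraph.dist_self, dist_eq_one_iff_adj.2 h]
        omega
      · obtain ⟨rfl, rfl, h⟩ := h
        simp only [Sum.elim_inl, Sum.elim_inr]
        omega
      · rcases h with ⟨rfl, h⟩ | ⟨rfl, rfl, h⟩
        · have := isLip_dist hW w _ _ h
          simp only [Sum.elim_inr]
          omega
        · have := isLip_dist hB o _ _ h
          simp only [Sum.elim_inr]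
          omega
    simpa using hlip.le_add_dist hc (.inl a) (.inr (i, z))

end hang

theorem edist_map_le {V W : Type*} {G : SimpleGraph V} {H : SimpleGraph W} (f : G →g H) (a b : V) :
    H.edist (f a) (f b) ≤ G.edist a b := by
  refine le_iInf fun p => ?_
  rw [← Walk.length_map f p]
  exact edist_le _

theorem IsKGDGraph.of_iso {k g d : ℕ} {V W : Type*} {G : SimpleGraph V} {H : SimpleGraph W}
    (e : G ≃g H) (h : IsKGDGraph k g d G) : IsKGDGraph k g d H := by
  obtain ⟨h1, h2, h3⟩ := h
  refine ⟨fun v => ?_, e.egirth_eq ▸ h2, ?_⟩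
  · rw [← h1 (e.symm v)]
    exact Nat.card_congr (e.symm.mapNeighborSet v)
  · rw [← h3]
    apply le_antisymm
    · refine ediam_le_of_edist_le fun a b => ?_
      have : H.edist (e (e.symm a)) (e (e.symm b)) ≤ _ := edist_map_le e.toHom _ _
      rw [e.apply_symm_apply, e.apply_symm_apply] at this
      exact this.trans edist_le_ediam
    · refine ediam_le_of_edist_le fun a b => ?_
      have : G.edist (e.symm (e a)) (e.symm (e b)) ≤ _ := edist_map_le e.symm.toHom _ _
      rw [e.symm_apply_apply, e.symm_apply_apply] at this
      exact this.trans edist_le_ediam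

theorem IsKGDGraph.exists_fin {k g d : ℕ} {V : Type*} [Finite V] {G : SimpleGraph V}
    (h : IsKGDGraph k g d G) : ∃ G' : SimpleGraph (Fin (Nat.card V)), IsKGDGraph k g d G' :=
  ⟨_, h.of_iso (Iso.map (Finite.equivFin V) G)⟩

theorem ediam_eq_of_dist {V : Type*} {G : SimpleGraph V} (hG : G.Connected) {d : ℕ}
    (hle : ∀ a b, G.dist a b ≤ d) {a b : V} (hd : d ≤ G.dist a b) : G.ediam = d := by
  apply le_antisymm
  · refine ediam_le_of_edist_le fun a b => ?_
    rw [← (hG a b).coe_dist_eq_edist]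
    exact_mod_cast hle a b
  · refine le_trans ?_ (edist_le_ediam (u := a) (v := b))
    rw [← (hG a b).coe_dist_eq_edist]
    exact_mod_cast hd

/-- A connected graph of girth greater than `N` whose vertices have degree `k`, except for `r` of
degree `2` and `r'` of degree `k - 2`. -/
structure IsBlock (k N : ℕ) {X : Type*} (G : SimpleGraph X) (r r' : X) : Prop where
  ne : r' ≠ r
  conn : G.Connected
  deg_left : ncdeg G r = 2
  deg_right : ncdeg G r' + 2 = k
  deg : ∀ z, z ≠ r → z ≠ r' → ncdeg G z = k
  cert : GirthCert N G

/-- Chaining `m` copies of a block onto a rooted graph. -/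
theorem exists_chain {k N K : ℕ} {X W : Type u} [Finite X] [Finite W] {GX : SimpleGraph X}
    {r r' : X} {GW : SimpleGraph W} {w : W} (hX : IsBlock k N GX r r') (hW : IsRooted k N GW w)
    (hKX : ∀ a b, GX.dist a b ≤ K) (hKW : ∀ a b, GW.dist a b ≤ K) (m : ℕ) :
    ∃ (Y : Type u) (_ : Finite Y) (GY : SimpleGraph Y) (y : Y) (E : ℕ), IsRooted k N GY y ∧
      Nat.card Y ≤ m * Nat.card X + Nat.card W ∧ m * GX.dist r r' ≤ E ∧
      E ≤ m * GX.dist r r' + K ∧ (∀ a, GY.dist a y ≤ E) ∧ (∃ a, GY.dist a y = E) ∧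
      ∀ a b, GY.dist a b ≤ E + K := by
  classical
  induction m with
  | zero =>
    have : Nonempty W := ⟨w⟩
    obtain ⟨a, ha⟩ := Finite.exists_max (fun a => GW.dist a w)
    exact ⟨W, inferInstance, GW, w, GW.dist a w, hW, by simp, by simp, by simpa using hKW a w, ha,
      ⟨a, rfl⟩, fun b c => (hKW b c).trans (by omega)⟩
  | succ m ih =>
    obtain ⟨Y, hfin, GY, y, E, hY, hcard, hE1, hE2, hE, ⟨a, ha⟩, hEK⟩ := ih
    let F := hang GX r GY y (⊥ : SimpleGraph PUnit.{u + 1}) ⟨⟩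
    have hP : (⊥ : SimpleGraph PUnit.{u + 1}).Connected := by
      rw [connected_iff_exists_forall_reachable]
      exact ⟨⟨⟩, fun _ => Reachable.refl _⟩
    have hF : F.Connected := hang_connected hX.conn hY.conn hP
    let y' : Y ⊕ {i // i ≠ r} × PUnit.{u + 1} := .inr (⟨r', hX.ne⟩, ⟨⟩)
    have hll : ∀ b c, F.dist (.inl b) (.inl c) ≤ GY.dist b c := dist_hang_inl_inl_le hY.conn
    have hlr : ∀ b i z, F.dist (.inl b) (.inr (i, z)) = GY.dist b y + GX.dist r i := by
      intro b i z
      have := dist_hang_inl_inr (y := y) (w := ⟨⟩) hX.conn hY.conn hP b i z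
      rw [show (⟨⟩ : PUnit.{u + 1}) = z from rfl, SimpleGraph.dist_self] at this
      exact this
    have hrr : ∀ i z j z', F.dist (.inr (i, z)) (.inr (j, z')) ≤ K := by
      intro i z j z'
      have := dist_hang_inr_inr_le (y := y) (w := ⟨⟩) hX.conn hY.conn hP i j z z'
      rw [show z' = (⟨⟩ : PUnit.{u + 1}) from rfl, show z = (⟨⟩ : PUnit.{u + 1}) from rfl,
        SimpleGraph.dist_self, zero_add, add_zero] at this
      exact this.trans (hKX i j)
    have : Nonempty (Y ⊕ {i // i ≠ r} × PUnit.{u + 1}) := ⟨y'⟩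
    obtain ⟨b, hb⟩ := Finite.exists_max (fun b => F.dist b y')
    have hb1 : E + GX.dist r r' ≤ F.dist b y' := by
      have := hb (.inl a)
      rwa [hlr, ha] at this
    have hb3 : F.dist b y' ≤ max (E + GX.dist r r') K := by
      obtain b | ⟨i, z⟩ := b
      · rw [hlr]
        have := hE b
        change _ + GX.dist r r' ≤ _
        omega
      · have := hrr i z ⟨r', hX.ne⟩ ⟨⟩
        exact this.trans (by omega)
    refine ⟨_, inferInstance, F, y', F.dist b y', ⟨hF, ?_, ?_, ?_, ?_⟩,
      ?_, ?_, ?_, hb, ⟨b, rfl⟩, ?_⟩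
    · rw [ncdeg_hang_inr_root, ncdeg_bot, zero_add]
      exact hX.deg_right
    · rintro (c | ⟨i, z⟩) hz
      · by_cases hc : c = y
        · rw [hc, ncdeg_hang_inl_root, hX.deg_left]
          exact hY.deg_root
        · rw [ncdeg_hang_inl_of_ne hc]
          exact hY.deg c hc
      · rw [show z = (⟨⟩ : PUnit.{u + 1}) from rfl, ncdeg_hang_inr_root, ncdeg_bot, zero_add]
        refine hX.deg i i.2 fun h => hz ?_
        exact congrArg Sum.inr (Prod.ext (Subtype.ext h) rfl)
    · exact girthCert_hang hX.cert hY.cert girthCert_bot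
    · exact hY.cyc.trans ⟨⟨hangInl, Sum.inl_injective⟩⟩
    · have : Nat.card {i // i ≠ r} ≤ Nat.card X :=
        Nat.card_le_card_of_injective _ Subtype.val_injective
      rw [Nat.card_sum, Nat.card_prod, Nat.card_unique (α := PUnit.{u + 1}), Nat.succ_mul]
      omega
    · rw [Nat.succ_mul]; omega
    · rw [Nat.succ_mul]; omega
    · rintro (c | ⟨i, z⟩) (e | ⟨j, z'⟩)
      · exact (hll c e).trans ((hEK c e).trans (by omega))
      · rw [hlr]
        have := hE c
        have := hKX r j
        omega
      · rw [SimpleGraph.dist_comm, hlr]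
        have := hE e
        have := hKX r i
        omega
      · exact (hrr _ _ _ _).trans (by omega)

/-- Capping a chain of blocks with a long even cycle, so that the diameter takes any prescribed
large value. -/
theorem exists_kgd {k N K m t : ℕ} {X W : Type u} [Finite X] [Finite W] {GX : SimpleGraph X}
    {r r' : X} {GW : SimpleGraph W} {w : W} (hN : 2 ≤ N) (hX : IsBlock k N GX r r')
    (hW : IsRooted k N GW w) (hKX : ∀ a b, GX.dist a b ≤ K) (hKW : ∀ a b, GW.dist a b ≤ K)
    (hm : K ≤ m) {d : ℕ} (hd1 : m * GX.dist r r' + 3 * K + N + 3 ≤ d)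
    (hd2 : d ≤ m * GX.dist r r' + t) :
    ∃ n, n ≤ m * Nat.card X + Nat.card W + 2 * t * Nat.card W ∧
      ∃ G : SimpleGraph (Fin n), IsKGDGraph k (N + 1) d G := by
  classical
  obtain ⟨Y, hfin, GY, y, E, hY, hcard, hE1, hE2, hE, ⟨a, ha⟩, hEK⟩ := exists_chain hX hW hKX hKW m
  have : Nonempty W := ⟨w⟩
  obtain ⟨b, hb⟩ := Finite.exists_max (fun a => GW.dist w a)
  have hbK := hKW w b
  have hδ : 1 ≤ GX.dist r r' := hX.conn.pos_dist_of_ne hX.ne.symm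
  have hmδ : m ≤ m * GX.dist r r' := Nat.le_mul_of_pos_right _ hδ
  obtain ⟨c, hc⟩ : ∃ c, E + c + GW.dist w b = d := ⟨d - E - GW.dist w b, by omega⟩
  obtain ⟨l, hl⟩ : ∃ l, l + 3 = 2 * c := ⟨2 * c - 3, by omega⟩
  have hC : (cycleGraph (l + 3)).Connected := cycleGraph_connected (n := l + 2)
  let F := hang (cycleGraph (l + 3)) 0 GY y GW w
  have hF : F.Connected := hang_connected hC hY.conn hW.conn
  have hcyc := dist_cycleGraph_le hl
  have hcard' : Nat.card (Y ⊕ {i : Fin (l + 3) // i ≠ 0} × W) ≤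
      m * Nat.card X + Nat.card W + 2 * t * Nat.card W := by
    have h1 : Nat.card {i : Fin (l + 3) // i ≠ 0} ≤ Nat.card (Fin (l + 3)) :=
      Nat.card_le_card_of_injective _ Subtype.val_injective
    have h2 : Nat.card {i : Fin (l + 3) // i ≠ 0} ≤ 2 * t := by
      rw [Nat.card_fin] at h1
      omega
    rw [Nat.card_sum, Nat.card_prod]
    exact Nat.add_le_add hcard (Nat.mul_le_mul_right _ h2)
  refine ⟨_, hcard', IsKGDGraph.exists_fin (G := F) ⟨?_, ?_, ?_⟩⟩
  · rintro (z | ⟨i, z⟩)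
    · by_cases hz : z = y
      · rw [hz]
        exact (ncdeg_hang_inl_root).trans (by rw [ncdeg_cycleGraph]; exact hY.deg_root)
      · exact (ncdeg_hang_inl_of_ne hz).trans (hY.deg z hz)
    · by_cases hz : z = w
      · rw [hz]
        exact (ncdeg_hang_inr_root i).trans (by rw [ncdeg_cycleGraph]; exact hW.deg_root)
      · exact (ncdeg_hang_inr_of_ne hz).trans (hW.deg z hz)
  · apply le_antisymm
    · have h1 : cycleGraph (N + 1) ⊑ F := hY.cyc.trans ⟨⟨hangInl, Sum.inl_injective⟩⟩
      obtain ⟨v, p, hp, hl⟩ := (cycleGraph_isContained_iff (by omega)).1 h1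
      rw [← hl]
      exact egirth_le_length hp
    · exact (girthCert_hang (girthCert_cycleGraph (by omega)) hY.cert hW.cert).le_egirth
  · have hne : (⟨c, by omega⟩ : Fin (l + 3)) ≠ 0 := by
      intro h
      have := congrArg Fin.val h
      simp at this
      omega
    refine ediam_eq_of_dist hF ?_ (a := .inl a) (b := .inr (⟨⟨c, by omega⟩, hne⟩, b)) ?_
    · rintro (z | ⟨i, z⟩) (z' | ⟨j, z'⟩)
      · exact (dist_hang_inl_inl_le hY.conn z z').trans ((hEK _ _).trans (by omega))
      · refine (dist_hang_inl_inr hC hY.conn hW.conn z j z').le.trans ?_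
        have := hE z
        have := hcyc 0 j
        have := hb z'
        omega
      · rw [SimpleGraph.dist_comm]
        refine (dist_hang_inl_inr hC hY.conn hW.conn z' i z).le.trans ?_
        have := hE z'
        have := hcyc 0 i
        have := hb z
        omega
      · refine (dist_hang_inr_inr_le hC hY.conn hW.conn i j z z').trans ?_
        have := hcyc i j
        have := hb z'
        have h2 := hb z
        rw [SimpleGraph.dist_comm] at h2
        omega
    · refine le_trans ?_ (dist_hang_inl_inr hC hY.conn hW.conn a ⟨⟨c, _⟩, hne⟩ b).ge
      have := le_dist_cycleGraph hl
      rw [ha, ← hc]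
      exact Nat.add_le_add_right (Nat.add_le_add_left this _) _

theorem fRatio_le {k g : ℕ} {c C : ℝ} {d₀ : ℕ} (h : ∀ d : ℕ, d₀ ≤ d →
    ∃ n : ℕ, (n : ℝ) ≤ c * d + C ∧ ∃ G : SimpleGraph (Fin n), IsKGDGraph k g d G) :
    fRatio k g ≤ c := by
  refine csInf_le ⟨0, ?_⟩ ⟨C, d₀, h⟩
  rintro c ⟨C, d₀, h⟩
  by_contra! hc
  obtain ⟨d, hd⟩ := exists_nat_gt (C / -c)
  obtain ⟨n, hn, -⟩ := h (max d d₀) (le_max_right _ _)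
  have h1 : (d : ℝ) ≤ (max d d₀ : ℕ) := by exact_mod_cast le_max_left _ _
  rw [div_lt_iff₀ (by linarith)] at hd
  have : (0 : ℝ) ≤ n := n.cast_nonneg
  nlinarith

theorem IsBlock.fRatio_le {k N : ℕ} {X : Type u} [Finite X] {GX : SimpleGraph X} {r r' : X}
    (hk : 3 ≤ k) (hN : 2 ≤ N) (hX : IsBlock k N GX r r') :
    fRatio k (N + 1) ≤ Nat.card X / GX.dist r r' := by
  obtain ⟨W, _, GW, w, hW⟩ := exists_isRooted.{u} k N hk hN
  obtain ⟨K, hKX, hKW⟩ : ∃ K, (∀ a b, GX.dist a b ≤ K) ∧ ∀ a b, GW.dist a b ≤ K := by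
    obtain ⟨K₁, h1⟩ := (Set.finite_range fun p : X × X => GX.dist p.1 p.2).bddAbove
    obtain ⟨K₂, h2⟩ := (Set.finite_range fun p : W × W => GW.dist p.1 p.2).bddAbove
    exact ⟨max K₁ K₂, fun a b => (h1 ⟨(a, b), rfl⟩).trans (le_max_left _ _),
      fun a b => (h2 ⟨(a, b), rfl⟩).trans (le_max_right _ _)⟩
  have hδ : 1 ≤ GX.dist r r' := hX.conn.pos_dist_of_ne hX.ne.symm
  set δ := GX.dist r r'
  set s := 3 * K + N + 3
  refine _root_.fRatio_le (C := Nat.card W + 2 * (s + δ) * Nat.card W) (d₀ := s + K * δ)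
    fun d hd => ?_
  have hmod := Nat.div_add_mod (d - s) δ
  have hlt := Nat.mod_lt (d - s) hδ
  rw [mul_comm] at hmod
  obtain ⟨n, hn, hG⟩ := exists_kgd (t := s + δ) (m := (d - s) / δ) hN hX hW hKX hKW
    ((Nat.le_div_iff_mul_le hδ).2 (by omega)) (d := d)
    (by change _ / δ * δ + 3 * K + N + 3 ≤ d; omega) (by change d ≤ _ / δ * δ + _; omega)
  refine ⟨n, ?_, hG⟩
  have h1 : (((d - s) / δ : ℕ) : ℝ) ≤ d / δ := by
    rw [le_div_iff₀ (by exact_mod_cast hδ)]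
    exact_mod_cast (by omega : (d - s) / δ * δ ≤ d)
  have h2 : (n : ℝ) ≤ ((d - s) / δ : ℕ) * Nat.card X + Nat.card W +
      2 * ((s + δ : ℕ) : ℝ) * Nat.card W := by exact_mod_cast hn
  have h3 := mul_le_mul_of_nonneg_right h1 (Nat.cast_nonneg (α := ℝ) (Nat.card X))
  have h4 : (d : ℝ) / δ * Nat.card X = Nat.card X / δ * d := by ring
  push_cast at h2 ⊢
  linarith

/-- A graph of girth greater than `N` with levels `0, …, T` whose vertices of degree other than
`k` lie in the first and last level, both of which have at most `s` vertices. -/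
structure IsTube (k N s T : ℕ) {Q : Type*} (G : SimpleGraph Q) (lam : Q → ℕ) : Prop where
  pos : 0 < T
  lip : IsLip G lam
  le : ∀ v, lam v ≤ T
  cert : GirthCert N G
  deg_le : ∀ v, ncdeg G v ≤ k
  deg : ∀ v, lam v ≠ 0 → lam v ≠ T → ncdeg G v = k
  deg_lt : ∀ v, lam v = 0 → ncdeg G v < k
  exists_top : ∃ v, lam v = T ∧ ncdeg G v < k
  desc : ∀ v, lam v ≠ 0 → ∃ u, G.Adj v u ∧ lam u + 1 = lam v
  parity : Even k → Even (∑ᶠ v ∈ {v | lam v = 0}, ncdeg G v)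
  card_zero : {v | lam v = 0}.ncard ≤ s
  card_top : {v | lam v = T}.ncard ≤ s

theorem IsTube.exists_reachable {k N s T : ℕ} {Q : Type*} {G : SimpleGraph Q} {lam : Q → ℕ}
    (h : IsTube k N s T G lam) (v : Q) : ∃ u, lam u = 0 ∧ G.Reachable v u := by
  induction hn : lam v generalizing v with
  | zero => exact ⟨v, hn, Reachable.refl _⟩
  | succ n ih =>
    obtain ⟨u, hu, hl⟩ := h.desc v (by omega)
    obtain ⟨x, hx, hr⟩ := ih u (by omega)
    exact ⟨x, hx, hu.reachable.trans hr⟩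

theorem even_sum_ncdeg {V : Type*} [Fintype V] (G : SimpleGraph V) : Even (∑ v, ncdeg G v) := by
  classical
  have := G.sum_degrees_eq_twice_card_edges
  simp_rw [ncdeg, Set.ncard_eq_toFinset_card', ← SimpleGraph.neighborFinset_def,
    SimpleGraph.card_neighborFinset_eq_degree]
  rw [this]
  exact even_two_mul _

theorem sum_le_ncard_mul {V : Type*} [Fintype V] {d : V → ℕ} {S : Set V} {k : ℕ}
    (h0 : ∀ v, v ∉ S → d v = 0) (hk : ∀ v, d v ≤ k) : ∑ v, d v ≤ S.ncard * k := by
  classical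
  rw [Set.ncard_eq_toFinset_card', ← smul_eq_mul, ← Finset.sum_const]
  rw [← Finset.sum_subset (Finset.subset_univ S.toFinset)
    (fun v _ hv => h0 v (by simpa using hv))]
  exact Finset.sum_le_sum fun v _ => hk v

theorem ncard_fiber_le {ι V : Type*} {s : ι → V} (hs : Function.Injective s) (v : V) :
    {i | s i = v}.ncard ≤ 1 := by
  have h : {i | s i = v}.Subsingleton := fun i hi j hj => hs (hi.trans hj.symm)
  exact (Set.ncard_le_one h.finite).2 fun a ha b hb => h ha hb

/-- Closing the bottom of a tube by a cycle carrying a vertex of degree `2`. -/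
theorem exists_closed_bottom (k N s : ℕ) (hk : 3 ≤ k) :
    ∃ C : ℕ, ∀ (T : ℕ) (Q : Type u) [Finite Q] (G : SimpleGraph Q) (lam : Q → ℕ),
      IsTube k N s T G lam →
      ∃ (U : Type u) (_ : Finite U) (H : SimpleGraph U) (j : Q → U) (r : U) (f : U → ℕ),
        Function.Injective j ∧ Nat.card U ≤ Nat.card Q + C ∧ GirthCert N H ∧
        ncdeg H r = 2 ∧ (∀ v, j v ≠ r) ∧ (∀ v, lam v ≠ 0 → ncdeg H (j v) = ncdeg G v) ∧
        (∀ z, z ≠ r → (∀ v, lam v = T → z ≠ j v) → ncdeg H z = k) ∧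
        (∀ z, H.Reachable r z) ∧ IsLip H f ∧ f r = 0 ∧ ∀ v, f (j v) = lam v := by
  classical
  obtain ⟨M, hM⟩ := exists_completion.{u} k N hk
  refine ⟨s + N + 3 + (s * k + (s + N + 3) * k + k) * M + 1, fun T Q _ G lam hQ => ?_⟩
  have := Fintype.ofFinite Q
  let B := {v : Q // lam v = 0}
  let b := Nat.card B
  have hbs : b ≤ s := hQ.card_zero
  let e : Fin b ≃ B := (Finite.equivFin B).symm
  let n := s + N
  let dQ : Q → ℕ := fun v => if lam v = 0 then k - ncdeg G v else 0
  let dC : Fin (n + 3) → ℕ := fun c => if c = 0 then 0 else k - 2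
  let tt : Fin b → Fin (n + 3) := fun i => ⟨i + 1, by omega⟩
  have htt : Function.Injective tt := fun i j h => by
    have := congrArg Fin.val h
    simp only [tt] at this
    exact Fin.ext (by omega)
  have htt0 : ∀ i, tt i ≠ 0 := fun i h => by
    have := congrArg Fin.val h
    simp [tt] at this
  obtain ⟨U, hU, H, j, h, hr⟩ := hM (Q ⊕ Fin (n + 3)) (G.sum (cycleGraph (n + 3)))
    (Sum.elim dQ dC) (Fin b) (fun i => .inl (e i)) (fun i => .inr (tt i))
    (girthCert_sum hQ.cert (girthCert_cycleGraph (by omega)))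
    (fun hk => by
      rw [Fintype.sum_sum_type]
      refine Even.add ?_ ?_
      · have hp := hQ.parity hk
        have h2 : ∑ v, Sum.elim dQ dC (.inl v) + ∑ᶠ v ∈ {v | lam v = 0}, ncdeg G v =
            ∑ v : Q, if lam v = 0 then k else 0 := by
          rw [finsum_mem_eq_finite_toFinset_sum _ (Set.toFinite _),
            show (Set.toFinite {v | lam v = 0}).toFinset = Finset.univ.filter (lam · = 0) by
              ext; simp, Finset.sum_filter, ← Finset.sum_add_distrib]
          refine Finset.sum_congr rfl fun v _ => ?_
          have := hQ.deg_le v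
          simp only [Sum.elim_inl, dQ]
          split <;> omega
        have h3 : Even (∑ v : Q, if lam v = 0 then k else 0) :=
          Finset.even_sum _ fun v _ => by split <;> simp [hk]
        rw [← h2, Nat.even_add] at h3
        exact h3.2 hp
      · refine Finset.even_sum _ fun v _ => ?_
        simp only [Sum.elim_inr, dC]
        split
        · simp
        · exact Even.tsub hk even_two)
    (by
      rintro (v | c)
      · have h1 : {i : Fin b | (Sum.inr (tt i) : Q ⊕ Fin (n + 3)) = .inl v} = ∅ := by simp
        rw [h1, Set.ncard_empty, add_zero, Sum.elim_inl]
        by_cases hv : lam v = 0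
        · refine (ncard_fiber_le (Sum.inl_injective.comp
            (Subtype.val_injective.comp e.injective)) _).trans ?_
          have := hQ.deg_lt v hv
          simp only [dQ, hv, if_true]
          omega
        · have h2 : {i : Fin b | (Sum.inl (e i).1 : Q ⊕ Fin (n + 3)) = .inl v} = ∅ := by
            ext i
            simp only [Sum.inl.injEq, Set.mem_ofPred_eq, Set.mem_empty_iff_false, iff_false]
            rintro rfl
            exact hv (e i).2
          rw [h2]
          simp
      · have h1 : {i : Fin b | (Sum.inl (e i).1 : Q ⊕ Fin (n + 3)) = .inr c} = ∅ := by simp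
        rw [h1, Set.ncard_empty, zero_add, Sum.elim_inr]
        by_cases hc : c = 0
        · have h2 : {i : Fin b | (Sum.inr (tt i) : Q ⊕ Fin (n + 3)) = .inr c} = ∅ := by
            ext i
            simp [hc, htt0]
          rw [h2]
          simp
        · refine (ncard_fiber_le (Sum.inr_injective.comp htt) _).trans ?_
          simp only [dC, hc, if_false]
          omega)
  have hdQ : ∀ v, ncdeg G v + dQ v ≤ k := fun v => by
    have := hQ.deg_le v
    simp only [dQ]
    split <;> omega
  have hC := cycleGraph_connected (n := n + 2)
  obtain ⟨f, hf, hfj⟩ := h.lip (Sum.elim lam 0) 0 (isLip_sum hQ.lip (fun _ _ _ => by simp))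
    (by
      rintro (v | c) hd
      · by_contra hne
        simp only [Sum.elim_inl] at hne
        simp [dQ, hne] at hd
      · rfl)
  have hcyc : ∀ c, H.Reachable (j (.inr 0)) (j (.inr c)) := fun c =>
    h.reachable ((hC 0 c).map (⟨Sum.inr, fun h => h⟩ : cycleGraph (n + 3) →g
      G.sum (cycleGraph (n + 3))))
  refine ⟨U, hU, H, fun v => j (.inl v), j (.inr 0), f, h.inj.comp Sum.inl_injective, ?_, h.cert,
    ?_, ?_, ?_, ?_, ?_, hf, ?_, fun v => hfj _⟩
  · refine h.card.trans ?_
    have h1 : ∑ v, Sum.elim dQ dC v ≤ s * k + (s + N + 3) * k := by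
      rw [Fintype.sum_sum_type]
      refine Nat.add_le_add ?_ ?_
      · refine (sum_le_ncard_mul (S := {v | lam v = 0}) (k := k) (fun v hv => if_neg hv)
          (fun v => ?_)).trans (Nat.mul_le_mul_right _ hQ.card_zero)
        exact (Nat.le_add_left _ _).trans (hdQ v)
      · refine (Finset.sum_le_card_nsmul _ _ k fun c _ => ?_).trans ?_
        · simp only [Sum.elim_inr, dC]
          split <;> omega
        · simp [n]
    have h2 := Nat.mul_le_mul_right M (Nat.add_le_add_right h1 k)
    rw [Nat.card_sum, Nat.card_fin]
    omega
  · rw [h.deg, ncdeg_sum_inr, ncdeg_cycleGraph]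
    simp [dC]
  · exact fun v hv => by simpa using h.inj hv
  · intro v hv
    rw [h.deg, ncdeg_sum_inl]
    simp [dQ, hv]
  · intro z hz hzT
    by_cases hzj : z ∈ Set.range j
    · obtain ⟨v | c, rfl⟩ := hzj
      · rw [h.deg, ncdeg_sum_inl, Sum.elim_inl]
        have hvT : lam v ≠ T := fun hv => hzT v hv rfl
        by_cases hv : lam v = 0
        · have := hQ.deg_le v
          simp only [dQ, hv, if_true]
          omega
        · simp [dQ, hv, hQ.deg v hv hvT]
      · have hc : c ≠ 0 := fun hc => hz (by rw [hc])
        rw [h.deg, ncdeg_sum_inr, ncdeg_cycleGraph]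
        simp only [Sum.elim_inr, dC, hc, if_false]
        omega
    · exact h.deg_new z hzj
  · intro z
    obtain ⟨v | c, hv⟩ := h.reach z
    · obtain ⟨u, hu, huv⟩ := hQ.exists_reachable v
      have h1 := hr (e.symm ⟨u, hu⟩)
      rw [e.apply_symm_apply] at h1
      have h2 := h.reachable (huv.map (⟨Sum.inl, fun h => h⟩ : G →g G.sum (cycleGraph (n + 3))))
      exact (hcyc _).trans (h1.symm.trans (h2.symm.trans hv))
    · exact (hcyc c).trans hv
  · exact hfj _

/-- Closing both ends of a tube gives a block. -/
theorem exists_isBlock_of_isTube (k N s : ℕ) (hk : 3 ≤ k) :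
    ∃ C : ℕ, ∀ (T : ℕ) (Q : Type u) [Finite Q] (G : SimpleGraph Q) (lam : Q → ℕ),
      IsTube k N s T G lam →
      ∃ (X : Type u) (_ : Finite X) (GX : SimpleGraph X) (r r' : X), IsBlock k N GX r r' ∧
        Nat.card X ≤ Nat.card Q + C ∧ T ≤ GX.dist r r' := by
  classical
  obtain ⟨C, hC⟩ := exists_closed_bottom.{u} k N s hk
  obtain ⟨M, hM⟩ := exists_completion.{u} k N hk
  refine ⟨C + 1 + (s * k + k + k) * M + 1, fun T Q _ G lam hQ => ?_⟩
  obtain ⟨U, _, H, j, r, f, hj, hcard, hcert, hr, hjr, hjdeg, hdeg, hreach, hf, hfr, hfj⟩ :=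
    hC T Q G lam hQ
  have := Fintype.ofFinite U
  have hle : ∀ z, ncdeg H z ≤ k := by
    intro z
    by_cases hz : z = r
    · rw [hz, hr]; omega
    by_cases hzT : ∃ v, lam v = T ∧ z = j v
    · obtain ⟨v, hv, rfl⟩ := hzT
      rw [hjdeg v (by have := hQ.pos; omega)]
      exact hQ.deg_le v
    · push Not at hzT
      exact (hdeg z hz hzT).le
  obtain ⟨x, hx, hxk⟩ := hQ.exists_top
  let dU : U → ℕ := fun z => if z = r then 0 else k - ncdeg H z
  have hdU : ∀ z, dU z ≠ 0 → ∃ v, lam v = T ∧ z = j v := by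
    intro z hz
    by_contra! hzT
    simp only [dU] at hz
    split_ifs at hz with hzr
    · exact hz rfl
    · rw [hdeg z hzr hzT] at hz
      omega
  have hdx : 1 ≤ dU (j x) := by
    simp only [dU, hjr x, if_false]
    rw [hjdeg x (by have := hQ.pos; omega)]
    omega
  obtain ⟨X, hX, GX, i, h, hi⟩ := hM (U ⊕ PUnit.{u + 1}) (H.sum ⊥)
    (Sum.elim dU (fun _ => k - 2)) Unit (fun _ => .inr ⟨⟩) (fun _ => .inl (j x))
    (girthCert_sum hcert girthCert_bot)
    (fun hk => by
      rw [Fintype.sum_sum_type]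
      refine Even.add ?_ ?_
      · have h2 : ∑ z, Sum.elim dU (fun _ : PUnit.{u + 1} => k - 2) (.inl z) + ∑ z, ncdeg H z =
            ∑ z, if z = r then 2 else k := by
          rw [← Finset.sum_add_distrib]
          refine Finset.sum_congr rfl fun z _ => ?_
          have := hle z
          simp only [Sum.elim_inl, dU]
          split
          · subst z; omega
          · omega
        have h3 : Even (∑ z : U, if z = r then 2 else k) :=
          Finset.even_sum _ fun v _ => by split <;> simp [hk]
        rw [← h2, Nat.even_add] at h3
        exact h3.2 (even_sum_ncdeg H)
      · exact Finset.even_sum _ fun _ _ => Even.tsub hk even_two)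
    (by
      rintro (v | v) <;> rw [ncard_unit_fiber, ncard_unit_fiber]
      · simp only [reduceCtorEq, if_false, Sum.inl.injEq, Sum.elim_inl]
        split
        · subst v; omega
        · omega
      · simp only [reduceCtorEq, if_false, Sum.elim_inr]
        split <;> omega)
  obtain ⟨f', hf', hfi⟩ := h.lip (Sum.elim f (fun _ => T)) T
    (isLip_sum hf (fun _ _ _ => by simp))
    (by
      rintro (z | z) hd
      · obtain ⟨v, hv, rfl⟩ := hdU z (by simpa using hd.ne')
        simp [hfj, hv]
      · rfl)
  have hconn : GX.Connected := by
    have h1 : ∀ z, GX.Reachable (i (.inl r)) (i (.inl z)) := fun z =>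
      h.reachable ((hreach z).map (⟨Sum.inl, fun h => h⟩ : H →g H.sum (⊥ : SimpleGraph PUnit)))
    rw [connected_iff_exists_forall_reachable]
    refine ⟨i (.inl r), fun z => ?_⟩
    obtain ⟨v | v, hv⟩ := h.reach z
    · exact (h1 v).trans hv
    · exact (h1 _).trans ((hi ()).symm.trans hv)
  refine ⟨X, hX, GX, i (.inl r), i (.inr ⟨⟩), ⟨?_, hconn, ?_, ?_, ?_, h.cert⟩, ?_, ?_⟩
  · exact fun he => by simpa using h.inj he
  · rw [h.deg, ncdeg_sum_inl, hr]
    simp [dU]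
  · rw [h.deg, ncdeg_sum_inr, ncdeg_bot, Sum.elim_inr]
    omega
  · intro z hz1 hz2
    by_cases hzi : z ∈ Set.range i
    · obtain ⟨v | v, rfl⟩ := hzi
      · have hv : v ≠ r := fun hv => hz1 (by rw [hv])
        have := hle v
        rw [h.deg, ncdeg_sum_inl]
        simp only [Sum.elim_inl, dU, hv, if_false]
        omega
      · exact absurd rfl hz2
    · exact h.deg_new z hzi
  · refine h.card.trans ?_
    have h1 : ∑ v, Sum.elim dU (fun _ : PUnit.{u + 1} => k - 2) v ≤ s * k + k := by
      rw [Fintype.sum_sum_type]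
      refine Nat.add_le_add ?_ ?_
      · refine (sum_le_ncard_mul (S := j '' {v | lam v = T}) (k := k) (fun z hz => ?_)
          (fun z => ?_)).trans (Nat.mul_le_mul_right _ ?_)
        · by_contra hne
          obtain ⟨v, hv, rfl⟩ := hdU z hne
          exact hz ⟨v, hv, rfl⟩
        · simp only [Sum.elim_inl, dU]
          split <;> omega
        · exact (Set.ncard_image_le (Set.toFinite _)).trans hQ.card_top
      · simp
    have h2 := Nat.mul_le_mul_right M (Nat.add_le_add_right h1 k)
    rw [Nat.card_sum, Nat.card_unique (α := PUnit.{u + 1})]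
    omega
  · have := hf'.le_add_dist hconn (i (.inl r)) (i (.inr ⟨⟩))
    rw [hfi, hfi, Sum.elim_inl, Sum.elim_inr, hfr, zero_add] at this
    exact this

theorem le_egirth_of_local {Q V : Type*} {GQ : SimpleGraph Q} {G : SimpleGraph V} {lam : Q → ℕ}
    (hlam : IsLip GQ lam) {n : ℕ} (hG : (n : ℕ∞) ≤ G.egirth)
    (h : ∀ x, ∃ θ : Q → V, Set.InjOn θ {z | lam x ≤ lam z ∧ lam z < lam x + n} ∧
      ∀ a b, lam x ≤ lam a → lam a < lam x + n → lam x ≤ lam b → lam b < lam x + n →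
        GQ.Adj a b → G.Adj (θ a) (θ b)) : (n : ℕ∞) ≤ GQ.egirth := by
  classical
  rw [SimpleGraph.le_egirth]
  intro a p hp
  by_contra! hlt
  have hlt' : p.length < n := by exact_mod_cast hlt
  obtain ⟨x, hx, hmin⟩ := p.support.toFinset.exists_min_image lam
    ⟨a, by simp⟩
  rw [List.mem_toFinset] at hx
  let q := p.rotate x hx
  have hq : q.IsCycle := (Walk.isCycle_rotate _).2 hp
  have hql : q.length = p.length := Walk.length_rotate _ _ _
  let S := {z | lam x ≤ lam z ∧ lam z < lam x + n}
  have hS : ∀ z ∈ q.support, z ∈ S := by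
    intro z hz
    refine ⟨hmin z ?_, ?_⟩
    · rw [List.mem_toFinset]
      exact (Walk.mem_support_rotate_iff _ _ _).1 hz
    · have h1 := hlam.le_add_length (q.takeUntil z hz)
      have h2 := q.length_takeUntil_le_length hz
      omega
  obtain ⟨θ, hθ, hadj⟩ := h x
  let φ : GQ.induce S →g G := ⟨fun z => θ z, fun {a b} hab =>
    hadj a b a.2.1 a.2.2 b.2.1 b.2.2 hab⟩
  have hφ : Function.Injective φ := fun a b hab => Subtype.ext (hθ a.2 b.2 hab)
  have h1 : (q.induce S hS).IsCycle := by
    refine Walk.IsCycle.of_map (f := (Embedding.induce S).toHom) ?_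
    rw [Walk.map_induce]
    exact hq
  have h2 := (Walk.isCycle_map_iff_of_injective hφ).2 h1
  have h3 := hG.trans (egirth_le_length h2)
  rw [Walk.length_map, ← Walk.length_map (Embedding.induce S).toHom, Walk.map_induce] at h3
  have h4 : n ≤ q.length := by exact_mod_cast h3
  omega

/-- A levelled graph together with a level-shifting isomorphism `ψ` from its first `g` levels onto
the levels `p, …, p + g - 1`. -/
structure IsStrip (k g p : ℕ) {V : Type*} (G : SimpleGraph V) (lev : V → ℕ) (ψ : V → V) :
    Prop where
  two_lt : 3 ≤ g
  le : g ≤ p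
  lip : IsLip G lev
  egirth : (g : ℕ∞) ≤ G.egirth
  deg : ∀ v, lev v ≠ 0 → lev v ≤ p → ncdeg G v = k
  desc : ∀ v, lev v ≠ 0 → lev v ≤ p → ∃ u, G.Adj v u ∧ lev u + 1 = lev v
  lev_map : ∀ v, lev v < g → lev (ψ v) = lev v + p
  adj_map : ∀ v w, lev v < g → lev w < g → (G.Adj (ψ v) (ψ w) ↔ G.Adj v w)
  inj : ∀ v w, lev v < g → lev w < g → ψ v = ψ w → v = w
  surj : ∀ x, p ≤ lev x → lev x < p + g → ∃ v, lev v < g ∧ ψ v = x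
  exists_zero : ∃ v, lev v = 0
  parity : Even k → Even (∑ᶠ v ∈ {v | lev v = 0}, ncdeg G v)

/-- `q` consecutive copies of the first `p` levels of a strip. -/
def stack {V : Type*} (G : SimpleGraph V) (lev : V → ℕ) (ψ : V → V) (p q : ℕ) :
    SimpleGraph (Fin q × {v : V // lev v < p}) where
  Adj a b := (a.1 = b.1 ∧ G.Adj a.2 b.2) ∨
    ((a.1 : ℕ) + 1 = b.1 ∧ lev b.2 = 0 ∧ G.Adj a.2 (ψ b.2)) ∨
    ((b.1 : ℕ) + 1 = a.1 ∧ lev a.2 = 0 ∧ G.Adj b.2 (ψ a.2))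
  symm := ⟨by
    rintro a b (⟨h1, h2⟩ | h | h)
    · exact .inl ⟨h1.symm, h2.symm⟩
    · exact .inr (.inr h)
    · exact .inr (.inl h)⟩
  loopless := ⟨by
    rintro a (⟨-, h⟩ | ⟨h, -⟩ | ⟨h, -⟩)
    · exact G.loopless.irrefl _ h
    · omega
    · omega⟩

namespace IsStrip

variable {k g p q : ℕ} {V : Type u} {G : SimpleGraph V} {lev : V → ℕ} {ψ : V → V}

/-- The level of a vertex of a stack. -/
def stackLev (lev : V → ℕ) (p q : ℕ) (a : Fin q × {v : V // lev v < p}) : ℕ :=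
  a.1 * p + lev a.2

theorem lev_of_adj_map (h : IsStrip k g p G lev ψ) {v w : V} (hv : lev v < p) (hw : lev w = 0)
    (hvw : G.Adj v (ψ w)) : lev v + 1 = p := by
  have h1 := h.lip _ _ hvw
  have h2 := h.lev_map w (by have := h.two_lt; omega)
  omega

theorem isLip_stackLev (h : IsStrip k g p G lev ψ) :
    IsLip (stack G lev ψ p q) (stackLev lev p q) := by
  rintro ⟨i, v, hv⟩ ⟨j, w, hw⟩ (⟨h1, h2⟩ | ⟨h1, h2, h3⟩ | ⟨h1, h2, h3⟩)
  · have := h.lip _ _ h2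
    simp only at h1 this
    simp only [stackLev, h1]
    omega
  · have := h.lev_of_adj_map hv h2 h3
    simp only at h1 h2
    simp only [stackLev, ← h1, h2, Nat.succ_mul]
    omega
  · have := h.lev_of_adj_map hw h2 h3
    simp only at h1 h2
    simp only [stackLev, ← h1, h2, Nat.succ_mul]
    omega

theorem girthCert_stack (h : IsStrip k (g + 1) p G lev ψ) : GirthCert g (stack G lev ψ p q) := by
  have hg := h.le
  refine girthCert_of_le_egirth (le_egirth_of_local h.isLip_stackLev h.egirth ?_)
  rintro ⟨j, x, hx⟩
  have hwin : ∀ i : Fin q, ∀ v : {v : V // lev v < p},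
      stackLev lev p q (j, ⟨x, hx⟩) ≤ stackLev lev p q (i, v) →
      stackLev lev p q (i, v) < stackLev lev p q (j, ⟨x, hx⟩) + (g + 1) →
      i = j ∨ ((i : ℕ) = j + 1 ∧ lev v < g + 1) := by
    rintro i ⟨v, hv⟩ h1 h2
    simp only [stackLev] at h1 h2 ⊢
    rcases lt_trichotomy (i : ℕ) j with hij | hij | hij
    · have := Nat.mul_le_mul_right p hij
      rw [Nat.succ_mul] at this
      omega
    · exact .inl (Fin.ext hij)
    · rcases Nat.lt_or_ge (j + 1) (i : ℕ) with hij' | hij'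
      · have := Nat.mul_le_mul_right p hij'
        rw [Nat.succ_mul, Nat.succ_mul] at this
        omega
      · have : (i : ℕ) = j + 1 := by omega
        rw [this, Nat.succ_mul] at h2
        exact .inr ⟨this, by omega⟩
  refine ⟨fun a => if a.1 = j then a.2 else ψ a.2, ?_, ?_⟩
  · rintro ⟨i, v⟩ ⟨h1, h2⟩ ⟨i', w⟩ ⟨h3, h4⟩ he
    have hv := v.2
    have hw := w.2
    rcases hwin i v h1 h2 with hi | ⟨hi, hi'⟩ <;> rcases hwin i' w h3 h4 with hj | ⟨hj, hj'⟩
    · subst hi hj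
      simp only [if_true] at he
      rw [Subtype.ext he]
    · have hne : i' ≠ j := by rintro rfl; omega
      simp only [hi, hne, if_true, if_false] at he
      have := h.lev_map w hj'
      rw [← he] at this
      omega
    · have hne : i ≠ j := by rintro rfl; omega
      simp only [hj, hne, if_true, if_false] at he
      have := h.lev_map v hi'
      rw [he] at this
      omega
    · have hne : i ≠ j := by rintro rfl; omega
      have hne' : i' ≠ j := by rintro rfl; omega
      simp only [hne, hne', if_false] at he
      have hii : i = i' := Fin.ext (by omega)
      rw [hii, Subtype.ext (h.inj _ _ hi' hj' he)]
  · rintro ⟨i, v⟩ ⟨i', w⟩ h1 h2 h3 h4 hadj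
    simp only
    rcases hwin i v h1 h2 with hi | ⟨hi, hi'⟩ <;> rcases hwin i' w h3 h4 with hj | ⟨hj, hj'⟩
    · subst hi hj
      simp only [if_true]
      rcases hadj with ⟨-, ha⟩ | ⟨ha, -⟩ | ⟨ha, -⟩
      · exact ha
      · simp at ha
      · simp at ha
    · have hne : i' ≠ j := by rintro rfl; omega
      simp only [hi, hne, if_true, if_false]
      rcases hadj with ⟨ha, -⟩ | ⟨ha, hb, hc⟩ | ⟨ha, -⟩
      · exact absurd (ha.symm.trans hi) hne
      · exact hc
      · simp only at ha; omega
    · have hne : i ≠ j := by rintro rfl; omega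
      simp only [hj, hne, if_true, if_false]
      rcases hadj with ⟨ha, -⟩ | ⟨ha, -⟩ | ⟨ha, hb, hc⟩
      · exact absurd (ha.trans hj) hne
      · simp only at ha; omega
      · exact hc.symm
    · have hne : i ≠ j := by rintro rfl; omega
      have hne' : i' ≠ j := by rintro rfl; omega
      simp only [hne, hne', if_false]
      rw [h.adj_map _ _ hi' hj']
      rcases hadj with ⟨-, ha⟩ | ⟨ha, -⟩ | ⟨ha, -⟩
      · exact ha
      · simp only at ha; omega
      · simp only at ha; omega

end IsStrip

namespace IsStrip

variable {k g p q : ℕ} {V : Type u} {G : SimpleGraph V} {lev : V → ℕ} {ψ : V → V}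

theorem pos (h : IsStrip k g p G lev ψ) : 3 ≤ p := h.two_lt.trans h.le

/-- Around a vertex of positive level, copy `i` and the next copy of a stack embed in `G`. -/
def up (ψ : V → V) (i : Fin q) (a : Fin q × {v : V // lev v < p}) : V :=
  if a.1 = i then a.2 else ψ a.2

/-- Around a vertex of level zero, copy `i` and the previous copy of a stack embed in `G`. -/
def down (ψ : V → V) (i : Fin q) (a : Fin q × {v : V // lev v < p}) : V :=
  if a.1 = i then ψ a.2 else a.2

theorem injOn_up (h : IsStrip k g p G lev ψ) {i : Fin q} {v : {v : V // lev v < p}}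
    (hv : lev v ≠ 0) : Set.InjOn (up ψ i) ((stack G lev ψ p q).neighborSet (i, v)) := by
  have hg := h.two_lt
  rintro ⟨j, w⟩ hw ⟨j', w'⟩ hw' he
  simp only [up] at he
  have h1 := w.2
  have h2 := w'.2
  rcases hw with ⟨ha, hb⟩ | ⟨ha, hb, hc⟩ | ⟨-, hb, -⟩
  · rcases hw' with ⟨ha', hb'⟩ | ⟨ha', hb', hc'⟩ | ⟨-, hb', -⟩
    · simp only at ha ha'
      subst ha ha'
      simp only [if_true] at he
      rw [Subtype.ext he]
    · simp only at ha ha' hb'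
      subst ha
      have hne : j' ≠ i := by rintro rfl; omega
      simp only [hne, if_true, if_false] at he
      have := h.lev_map w' (by omega)
      rw [← he] at this
      omega
    · exact absurd hb' hv
  · simp only at ha hb
    have hne : j ≠ i := by rintro rfl; omega
    rcases hw' with ⟨ha', hb'⟩ | ⟨ha', hb', hc'⟩ | ⟨-, hb', -⟩
    · simp only at ha'
      subst ha'
      simp only [hne, if_true, if_false] at he
      have := h.lev_map w (by omega)
      rw [he] at this
      omega
    · simp only at ha' hb'
      have hne' : j' ≠ i := by rintro rfl; omega
      simp only [hne, hne', if_false] at he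
      have hjj : j = j' := Fin.ext (by omega)
      rw [hjj, Subtype.ext (h.inj _ _ (by omega) (by omega) he)]
    · exact absurd hb' hv
  · exact absurd hb hv

theorem image_up_subset {i : Fin q} {v : {v : V // lev v < p}} (hv : lev v ≠ 0) :
    up ψ i '' (stack G lev ψ p q).neighborSet (i, v) ⊆ G.neighborSet v := by
  rintro _ ⟨⟨j, w⟩, hw, rfl⟩
  rcases hw with ⟨ha, hb⟩ | ⟨ha, hb, hc⟩ | ⟨-, hb, -⟩
  · simp only at ha
    subst ha
    simpa [up] using hb
  · simp only at ha
    have hne : j ≠ i := by rintro rfl; omega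
    simpa [up, hne] using hc
  · exact absurd hb hv

theorem injOn_down (h : IsStrip k g p G lev ψ) {i : Fin q} {v : {v : V // lev v < p}}
    (hv : lev v = 0) : Set.InjOn (down ψ i) ((stack G lev ψ p q).neighborSet (i, v)) := by
  have hg := h.two_lt
  have hp := h.pos
  rintro ⟨j, w⟩ hw ⟨j', w'⟩ hw' he
  simp only [down] at he
  have h1 := w.2
  have h2 := w'.2
  rcases hw with ⟨ha, hb⟩ | ⟨ha, hb, hc⟩ | ⟨ha, hb, hc⟩
  · simp only at ha
    subst ha
    have hlw := h.lip _ _ hb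
    simp only at hlw
    rcases hw' with ⟨ha', hb'⟩ | ⟨ha', hb', hc'⟩ | ⟨ha', hb', hc'⟩
    · simp only at ha'
      subst ha'
      simp only [if_true] at he
      have hlw' := h.lip _ _ hb'
      simp only at hlw'
      rw [Subtype.ext (h.inj _ _ (by omega) (by omega) he)]
    · have := h.lev_of_adj_map v.2 hb' hc'
      omega
    · simp only at ha'
      have hne' : j' ≠ i := by rintro rfl; omega
      simp only [hne', if_true, if_false] at he
      have := h.lev_map w (by omega)
      rw [he] at this
      omega
  · have := h.lev_of_adj_map v.2 hb hc
    omega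
  · simp only at ha
    have hne : j ≠ i := by rintro rfl; omega
    rcases hw' with ⟨ha', hb'⟩ | ⟨ha', hb', hc'⟩ | ⟨ha', hb', hc'⟩
    · simp only at ha'
      subst ha'
      have hlw' := h.lip _ _ hb'
      simp only at hlw'
      simp only [hne, if_true, if_false] at he
      have := h.lev_map w' (by omega)
      rw [← he] at this
      omega
    · have := h.lev_of_adj_map v.2 hb' hc'
      omega
    · simp only at ha'
      have hne' : j' ≠ i := by rintro rfl; omega
      simp only [hne, hne', if_false] at he
      have hjj : j = j' := Fin.ext (by omega)
      rw [hjj, Subtype.ext he]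

theorem image_down_subset (h : IsStrip k g p G lev ψ) {i : Fin q} {v : {v : V // lev v < p}}
    (hv : lev v = 0) :
    down ψ i '' (stack G lev ψ p q).neighborSet (i, v) ⊆ G.neighborSet (ψ v) := by
  have hg := h.two_lt
  rintro _ ⟨⟨j, w⟩, hw, rfl⟩
  rcases hw with ⟨ha, hb⟩ | ⟨ha, hb, hc⟩ | ⟨ha, hb, hc⟩
  · simp only at ha
    subst ha
    have hlw := h.lip _ _ hb
    simp only at hlw
    simpa [down] using (h.adj_map v w (by omega) (by omega)).2 hb
  · have := h.lev_of_adj_map v.2 hb hc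
    have := h.pos
    omega
  · simp only at ha
    have hne : j ≠ i := by rintro rfl; omega
    simpa [down, hne] using hc.symm

theorem ncdeg_map (h : IsStrip k g p G lev ψ) {v : V} (hv : lev v = 0) : ncdeg G (ψ v) = k := by
  have hg := h.pos
  have := h.lev_map v (by have := h.two_lt; omega)
  exact h.deg _ (by omega) (by omega)

theorem ncdeg_stack_le [Finite V] (h : IsStrip k g p G lev ψ)
    (a : Fin q × {v : V // lev v < p}) : ncdeg (stack G lev ψ p q) a ≤ k := by
  obtain ⟨i, v⟩ := a
  by_cases hv : lev v = 0
  · rw [ncdeg, ← (h.injOn_down hv).ncard_image, ← h.ncdeg_map hv]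
    exact Set.ncard_le_ncard (h.image_down_subset hv)
  · rw [ncdeg, ← (h.injOn_up hv).ncard_image, ← h.deg v hv v.2.le]
    exact Set.ncard_le_ncard (image_up_subset hv)

theorem ncdeg_stack_of_ne_zero (h : IsStrip k g p G lev ψ) {i : Fin q}
    {v : {v : V // lev v < p}} (hv : lev v ≠ 0) (hiv : (i : ℕ) + 1 < q ∨ lev v + 1 < p) :
    ncdeg (stack G lev ψ p q) (i, v) = k := by
  have hg := h.two_lt
  rw [ncdeg, ← (h.injOn_up hv).ncard_image, ← h.deg v hv v.2.le]
  congr 1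
  refine (image_up_subset hv).antisymm fun x hx => ?_
  have hvp := v.2
  have hlx := h.lip _ _ hx
  rcases Nat.lt_or_ge (lev x) p with hxp | hxp
  · exact ⟨(i, ⟨x, hxp⟩), .inl ⟨rfl, hx⟩, by simp [up]⟩
  · obtain ⟨w, hw, rfl⟩ := h.surj x hxp (by omega)
    have := h.lev_map w hw
    have hi : (i : ℕ) + 1 < q := by omega
    have hne : (⟨i + 1, hi⟩ : Fin q) ≠ i := fun he => by
      have := congrArg Fin.val he
      simp at this
    have hw0 : lev w = 0 := by omega
    exact ⟨(⟨i + 1, hi⟩, ⟨w, by omega⟩), .inr (.inl ⟨rfl, hw0, hx⟩), by simp [up, hne]⟩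

theorem ncdeg_stack_of_eq_zero (h : IsStrip k g p G lev ψ) {i : Fin q}
    {v : {v : V // lev v < p}} (hv : lev v = 0) (hi : (i : ℕ) ≠ 0) :
    ncdeg (stack G lev ψ p q) (i, v) = k := by
  have hg := h.two_lt
  have hp := h.pos
  rw [ncdeg, ← (h.injOn_down hv).ncard_image, ← h.ncdeg_map hv]
  congr 1
  refine (h.image_down_subset hv).antisymm fun x hx => ?_
  have hlv := h.lev_map v (by omega)
  have hlx := h.lip _ _ hx
  rcases Nat.lt_or_ge (lev x) p with hxp | hxp
  · have hiq := i.2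
    have hne : (⟨i - 1, by omega⟩ : Fin q) ≠ i := fun he => by
      have := congrArg Fin.val he
      simp only at this
      omega
    refine ⟨(⟨i - 1, by omega⟩, ⟨x, hxp⟩), .inr (.inr ⟨?_, hv, hx.symm⟩), by simp [down, hne]⟩
    simp only
    omega
  · obtain ⟨w, hw, rfl⟩ := h.surj x hxp (by omega)
    have := h.lev_map w hw
    exact ⟨(i, ⟨w, by omega⟩), .inl ⟨rfl, (h.adj_map v w (by omega) hw).1 hx⟩, by simp [down]⟩

theorem ncdeg_stack_bottom (h : IsStrip k g p G lev ψ) {i : Fin q} {v : {v : V // lev v < p}}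
    (hv : lev v = 0) (hi : (i : ℕ) = 0) : ncdeg (stack G lev ψ p q) (i, v) = ncdeg G v := by
  have hp := h.pos
  have h1 : ∀ w, (stack G lev ψ p q).Adj (i, v) w ↔ w.1 = i ∧ G.Adj v w.2 := by
    intro w
    constructor
    · rintro (⟨ha, hb⟩ | ⟨ha, hb, hc⟩ | ⟨ha, hb, hc⟩)
      · exact ⟨ha.symm, hb⟩
      · have := h.lev_of_adj_map v.2 hb hc
        omega
      · simp only at ha
        omega
    · exact fun ⟨ha, hb⟩ => .inl ⟨ha.symm, hb⟩
  refine Set.ncard_congr (fun w _ => w.2) (fun w hw => ((h1 w).1 hw).2) ?_ ?_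
  · rintro ⟨j, w⟩ ⟨j', w'⟩ hw hw' he
    have hj := ((h1 _).1 hw).1
    have hj' := ((h1 _).1 hw').1
    simp only at hj hj'
    exact Prod.ext (hj.trans hj'.symm) (Subtype.ext he)
  · intro x hx
    have := h.lip _ _ hx
    exact ⟨(i, ⟨x, by omega⟩), (h1 _).2 ⟨rfl, hx⟩, rfl⟩

theorem ncdeg_stack_bottom_lt [Finite V] (h : IsStrip k g p G lev ψ) {i : Fin q}
    {v : {v : V // lev v < p}} (hv : lev v = 0) (hi : (i : ℕ) = 0) :
    ncdeg (stack G lev ψ p q) (i, v) < k := by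
  have hg := h.two_lt
  have hp := h.pos
  rw [ncdeg, ← (h.injOn_down hv).ncard_image, ← h.ncdeg_map hv]
  refine Set.ncard_lt_ncard ((h.image_down_subset hv).ssubset_of_ne fun he => ?_)
  have hlv := h.lev_map v (by omega)
  obtain ⟨x, hx, hlx⟩ := h.desc (ψ v) (by omega) (by omega)
  obtain ⟨⟨j, w⟩, hw, hwx⟩ := he.ge hx
  rcases hw with ⟨ha, hb⟩ | ⟨ha, hb, hc⟩ | ⟨ha, hb, hc⟩
  · simp only at ha
    subst ha
    have h1 := h.lip _ _ hb
    simp only at h1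
    have h2 := h.lev_map w (by omega)
    simp only [down, if_true] at hwx
    rw [hwx] at h2
    omega
  · have := h.lev_of_adj_map v.2 hb hc
    omega
  · simp only at ha
    omega

theorem exists_stack_top [Finite V] (h : IsStrip k g p G lev ψ) {i : Fin q}
    (hi : (i : ℕ) + 1 = q) :
    ∃ v : {v : V // lev v < p}, lev v + 1 = p ∧ ncdeg (stack G lev ψ p q) (i, v) < k := by
  have hg := h.two_lt
  have hp := h.pos
  obtain ⟨u, hu⟩ := h.exists_zero
  have hlu := h.lev_map u (by omega)
  obtain ⟨x, hx, hlx⟩ := h.desc (ψ u) (by omega) (by omega)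
  have hx0 : lev x ≠ 0 := by omega
  refine ⟨⟨x, by omega⟩, by simp only; omega, ?_⟩
  rw [ncdeg, ← (h.injOn_up (v := ⟨x, by omega⟩) hx0).ncard_image,
    ← h.deg x hx0 (by omega)]
  refine Set.ncard_lt_ncard ((image_up_subset (v := ⟨x, by omega⟩) hx0).ssubset_of_ne
    fun he => ?_)
  obtain ⟨⟨j, w⟩, hw, hwx⟩ := he.ge hx.symm
  rcases hw with ⟨ha, hb⟩ | ⟨ha, hb, hc⟩ | ⟨ha, hb, hc⟩
  · simp only at ha
    subst ha
    have := w.2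
    simp only [up, if_true] at hwx
    rw [hwx] at this
    omega
  · have := j.2
    simp only at ha
    omega
  · exact hx0 hb

theorem isTube_stack [Finite V] (h : IsStrip k (g + 1) p G lev ψ) (q : ℕ) :
    IsTube k g (Nat.card {v // lev v < p}) (q * p + (p - 1)) (stack G lev ψ p (q + 1))
      (stackLev lev p (q + 1)) := by
  have hp := h.pos
  have hzero : ∀ (i : Fin (q + 1)) (v : {v : V // lev v < p}),
      stackLev lev p (q + 1) (i, v) = 0 ↔ (i : ℕ) = 0 ∧ lev v = 0 := by
    intro i v
    simp only [stackLev, Nat.add_eq_zero_iff, Nat.mul_eq_zero]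
    omega
  have htop : ∀ (i : Fin (q + 1)) (v : {v : V // lev v < p}),
      stackLev lev p (q + 1) (i, v) = q * p + (p - 1) ↔ (i : ℕ) = q ∧ lev v + 1 = p := by
    rintro i ⟨v, hv⟩
    have hi := i.2
    simp only [stackLev]
    constructor
    · intro he
      have hiq : (i : ℕ) = q := by
        by_contra hne
        have := Nat.mul_le_mul_right p (by omega : (i : ℕ) + 1 ≤ q)
        rw [Nat.succ_mul] at this
        omega
      rw [hiq] at he
      omega
    · rintro ⟨h1, h2⟩
      rw [h1]
      omega
  refine ⟨by omega, h.isLip_stackLev, ?_, h.girthCert_stack, h.ncdeg_stack_le, ?_, ?_, ?_, ?_, ?_,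
    ?_, ?_⟩
  · rintro ⟨i, v, hv⟩
    have := Nat.mul_le_mul_right p (Nat.le_of_lt_succ i.2)
    simp only [stackLev]
    omega
  · rintro ⟨i, v⟩ h0 hT
    rw [Ne, hzero] at h0
    rw [Ne, htop] at hT
    have hv := v.2
    have hi := i.2
    by_cases hv0 : lev v = 0
    · exact h.ncdeg_stack_of_eq_zero hv0 (by omega)
    · exact h.ncdeg_stack_of_ne_zero hv0 (by omega)
  · rintro ⟨i, v⟩ h0
    rw [hzero] at h0
    exact h.ncdeg_stack_bottom_lt h0.2 h0.1
  · obtain ⟨v, hv, hd⟩ := h.exists_stack_top (i := Fin.last q) rfl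
    exact ⟨(Fin.last q, v), (htop _ _).2 ⟨rfl, hv⟩, hd⟩
  · rintro ⟨i, v⟩ h0
    rw [Ne, hzero] at h0
    have hv := v.2
    by_cases hv0 : lev v = 0
    · have hlv := h.lev_map v (by omega)
      obtain ⟨x, hx, hlx⟩ := h.desc (ψ v) (by omega) (by omega)
      have hi := i.2
      obtain ⟨n, hn⟩ : ∃ n, (i : ℕ) = n + 1 := ⟨i - 1, by omega⟩
      refine ⟨(⟨n, by omega⟩, ⟨x, by omega⟩), .inr (.inr ⟨hn.symm, hv0, hx.symm⟩), ?_⟩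
      simp only [stackLev, hn, Nat.succ_mul]
      omega
    · obtain ⟨x, hx, hlx⟩ := h.desc v hv0 hv.le
      refine ⟨(i, ⟨x, by omega⟩), .inl ⟨rfl, hx⟩, ?_⟩
      simp only [stackLev]
      omega
  · intro hk
    convert h.parity hk using 1
    refine finsum_mem_eq_of_bijOn (fun a => a.2.1) ⟨?_, ?_, ?_⟩ ?_
    · rintro ⟨i, v⟩ ha
      exact ((hzero i v).1 ha).2
    · rintro ⟨i, v⟩ ha ⟨j, w⟩ hb he
      have h1 := ((hzero i v).1 ha).1
      have h2 := ((hzero j w).1 hb).1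
      exact Prod.ext (Fin.ext (h1.trans h2.symm)) (Subtype.ext he)
    · intro v hv
      have hv' : lev v = 0 := hv
      exact ⟨(0, ⟨v, by omega⟩), (hzero _ _).2 ⟨rfl, hv⟩, rfl⟩
    · rintro ⟨i, v⟩ ha
      have := (hzero i v).1 ha
      exact h.ncdeg_stack_bottom this.2 this.1
  · rw [← Set.ncard_univ]
    refine Set.ncard_le_ncard_of_injOn Prod.snd (fun _ _ => Set.mem_univ _) ?_
    rintro ⟨i, v⟩ ha ⟨j, w⟩ hb he
    have h1 := ((hzero i v).1 ha).1
    have h2 := ((hzero j w).1 hb).1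
    exact Prod.ext (Fin.ext (h1.trans h2.symm)) he
  · rw [← Set.ncard_univ]
    refine Set.ncard_le_ncard_of_injOn Prod.snd (fun _ _ => Set.mem_univ _) ?_
    rintro ⟨i, v⟩ ha ⟨j, w⟩ hb he
    have h1 := ((htop i v).1 ha).1
    have h2 := ((htop j w).1 hb).1
    exact Prod.ext (Fin.ext (h1.trans h2.symm)) he

/-- The ratio between the size and the number of levels of a period bounds `fRatio`. -/
theorem fRatio_le [Finite V] (hk : 3 ≤ k) (h : IsStrip k g p G lev ψ) :
    fRatio k g ≤ Nat.card {v // lev v < p} / p := by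
  obtain ⟨g, rfl⟩ : ∃ n, g = n + 1 := ⟨g - 1, by have := h.two_lt; omega⟩
  have hg := h.two_lt
  have hp := h.pos
  set a := Nat.card {v // lev v < p}
  obtain ⟨C, hC⟩ := exists_isBlock_of_isTube.{u} k g a hk
  have hle : ∀ q : ℕ, fRatio k (g + 1) ≤ a / p + (a + C) / (q + 1) := by
    intro q
    obtain ⟨X, _, GX, r, r', hX, hcard, hdist⟩ := hC _ _ _ _ (h.isTube_stack q)
    refine (hX.fRatio_le hk (by omega)).trans ?_
    rw [Nat.card_prod, Nat.card_fin] at hcard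
    change Nat.card X ≤ (q + 1) * a + C at hcard
    have h1 : (q + 1) * (p : ℝ) ≤ GX.dist r r' + 1 := by
      exact_mod_cast (by rw [Nat.succ_mul]; omega : (q + 1) * p ≤ GX.dist r r' + 1)
    have h2 : (Nat.card X : ℝ) ≤ (q + 1) * a + C := by exact_mod_cast hcard
    have hp' : (3 : ℝ) ≤ p := by exact_mod_cast hp
    have hq : (0 : ℝ) ≤ q := q.cast_nonneg
    have hδ : (0 : ℝ) < GX.dist r r' := by nlinarith
    have ha : (0 : ℝ) ≤ a := a.cast_nonneg
    have hC0 : (0 : ℝ) ≤ C := C.cast_nonneg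
    rw [div_le_iff₀ hδ, div_add_div _ _ (by positivity) (by positivity), div_mul_eq_mul_div,
      le_div_iff₀ (by positivity)]
    have h3 := mul_le_mul_of_nonneg_right h2 (by positivity : 0 ≤ (p : ℝ) * (q + 1))
    have h4 := mul_le_mul_of_nonneg_right (sub_le_iff_le_add.2 h1)
      (by positivity : 0 ≤ (a : ℝ) * (q + 1) + p * (a + C))
    have h5 : 0 ≤ (a : ℝ) * (q + 1) * (p * (p - 3) + (2 * p - 1)) :=
      mul_nonneg (by positivity) (by nlinarith)
    have h6 : 0 ≤ (C : ℝ) * (q + 1) * (p * (p - 3) + p) :=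
      mul_nonneg (by positivity) (by nlinarith)
    have h7 : 0 ≤ (p : ℝ) * (a + C) * q := by positivity
    linarith
  have hlim : Filter.Tendsto (fun q : ℕ => (a : ℝ) / p + (a + C) / (q + 1)) Filter.atTop
      (nhds (a / p + 0)) := by
    refine tendsto_const_nhds.add ?_
    have := (tendsto_one_div_add_atTop_nhds_zero_nat (𝕜 := ℝ)).const_mul ((a : ℝ) + C)
    simpa [div_eq_mul_inv] using this
  rw [add_zero] at hlim
  exact ge_of_tendsto' hlim hle

end IsStrip

section repeatable

variable {V : Type u} (G : SimpleGraph V) (N0 : Set V) (D : ℕ)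

/-- The distance of a vertex from `N0`. -/
noncomputable def distFrom (v : V) : ℕ∞ := ⨅ u ∈ N0, G.edist u v

open Classical in
/-- The level of a vertex, set to `D + 1` for vertices that cannot be reached from `N0`. -/
noncomputable def levelOf (v : V) : ℕ :=
  if distFrom G N0 v = ⊤ then D + 1 else (distFrom G N0 v).toNat

variable {G N0 D}

theorem distFrom_le_add_one {a b : V} (h : G.Adj a b) :
    distFrom G N0 b ≤ distFrom G N0 a + 1 := by
  rw [← tsub_le_iff_right]
  refine le_iInf₂ fun u hu => ?_
  rw [tsub_le_iff_right]
  refine (iInf₂_le u hu).trans ((G.edist_triangle (v := a)).trans ?_)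
  rw [edist_eq_one_iff_adj.2 h]

theorem mem_levelSet_iff {v : V} {i : ℕ} (hi : i ≤ D) :
    v ∈ levelSet G N0 i ↔ levelOf G N0 D v = i := by
  change distFrom G N0 v = i ↔ _
  rw [levelOf]
  split_ifs with h
  · simp only [h, ENat.top_ne_natCast, false_iff]
    omega
  · rw [← ENat.natCast_toNat h, Nat.cast_inj, ENat.natCast_toNat h]

theorem isLip_levelOf : IsLip G (levelOf G N0 D) := by
  intro a b hab
  have h1 := distFrom_le_add_one (N0 := N0) hab
  have h2 := distFrom_le_add_one (N0 := N0) hab.symm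
  rw [levelOf, levelOf]
  by_cases ha : distFrom G N0 a = ⊤
  · have hb : distFrom G N0 b = ⊤ := by
      rw [ha, top_le_iff] at h2
      simpa using h2
    simp [ha, hb]
  · have hb : distFrom G N0 b ≠ ⊤ := ne_top_of_le_ne_top (by simpa using ha) h1
    rw [if_neg ha, if_neg hb]
    rw [← ENat.natCast_toNat ha, ← ENat.natCast_toNat hb] at h1
    exact_mod_cast h1

theorem exists_mem_of_distFrom_lt {v : V} {n : ℕ∞} (h : distFrom G N0 v < n) :
    ∃ u ∈ N0, G.edist u v < n := by
  by_contra! hc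
  exact absurd (le_iInf₂ hc) (not_le.2 h)

theorem exists_adj_levelOf {v : V} (h0 : levelOf G N0 D v ≠ 0) (hD : levelOf G N0 D v ≤ D) :
    ∃ u, G.Adj v u ∧ levelOf G N0 D u + 1 = levelOf G N0 D v := by
  obtain ⟨i, hi⟩ := Nat.exists_eq_succ_of_ne_zero h0
  have hv : distFrom G N0 v = (i + 1 : ℕ) := (mem_levelSet_iff (by omega)).2 hi
  obtain ⟨u, hu, huv⟩ := exists_mem_of_distFrom_lt (n := (i + 2 : ℕ))
    (by rw [hv]; exact_mod_cast Nat.lt_succ_self _)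
  obtain ⟨w, hw⟩ := exists_walk_of_edist_ne_top (SimpleGraph.edist_comm (G := G) ▸ huv.ne_top :
    G.edist v u ≠ ⊤)
  rw [SimpleGraph.edist_comm, ← hw] at huv
  have hlen : w.length < i + 2 := by exact_mod_cast huv
  cases w with
  | nil =>
    have : distFrom G N0 v ≤ 0 := (iInf₂_le v hu).trans (by simp)
    rw [hv] at this
    simp at this
  | @cons _ x _ hx p =>
    refine ⟨x, hx, ?_⟩
    have h1 : distFrom G N0 x ≤ i := by
      refine (iInf₂_le u hu).trans ?_
      rw [SimpleGraph.edist_comm]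
      refine (edist_le p).trans ?_
      simp only [Walk.length_cons] at hlen
      exact_mod_cast (by omega : p.length ≤ i)
    obtain ⟨m, hm⟩ := ENat.ne_top_iff_exists.1 (ne_top_of_le_ne_top (ENat.natCast_ne_top i) h1)
    have hmi : m ≤ i := by rw [← hm] at h1; exact_mod_cast h1
    have h2 : levelOf G N0 D x = m := (mem_levelSet_iff (by omega)).1 hm.symm
    have h3 := isLip_levelOf (N0 := N0) (D := D) _ _ hx.symm
    omega

theorem IsRepeatable.exists_isStrip [Fintype V] {k g : ℕ} (hg : 3 ≤ g)
    (h : IsRepeatable k g G N0 D) :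
    ∃ ψ : V → V, IsStrip k g (D + 1 - g) G (levelOf G N0 D) ψ := by
  classical
  have hlong := h.long
  obtain ⟨φ, hφ⟩ := h.iso
  have hA : ∀ v, v ∈ (⋃ l ∈ Finset.range g, levelSet G N0 l) ↔ levelOf G N0 D v < g := by
    intro v
    simp only [Set.mem_iUnion, Finset.mem_range, exists_prop]
    constructor
    · rintro ⟨i, hi, hv⟩
      rw [mem_levelSet_iff (D := D) (by omega)] at hv
      omega
    · exact fun hv => ⟨_, hv, (mem_levelSet_iff (by omega)).2 rfl⟩
  have hB : ∀ v, D + 1 - g ≤ levelOf G N0 D v → levelOf G N0 D v < D + 1 - g + g →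
      v ∈ (⋃ l ∈ Finset.range g, levelSet G N0 (l + (D + 1 - g))) := by
    intro v h1 h2
    simp only [Set.mem_iUnion, Finset.mem_range, exists_prop]
    exact ⟨levelOf G N0 D v - (D + 1 - g), by omega,
      (mem_levelSet_iff (D := D) (by omega)).2 (by omega)⟩
  let ψ : V → V := fun v => if hv : levelOf G N0 D v < g then φ ⟨v, (hA v).2 hv⟩ else v
  have hψ : ∀ v (hv : levelOf G N0 D v < g), ψ v = φ ⟨v, (hA v).2 hv⟩ := fun v hv => dif_pos hv
  refine ⟨ψ, hg, by omega, isLip_levelOf, h.girth_ge, ?_, ?_, ?_, ?_, ?_, ?_, ?_, ?_⟩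
  · intro v h1 h2
    exact h.middle_regular (levelOf G N0 D v) (by omega) (by omega) v
      ((mem_levelSet_iff (by omega)).2 rfl)
  · exact fun v h1 h2 => exists_adj_levelOf h1 (by omega)
  · intro v hv
    rw [hψ v hv]
    exact (mem_levelSet_iff (by omega)).1 (hφ ⟨v, (hA v).2 hv⟩ (levelOf G N0 D v) hv
      ((mem_levelSet_iff (by omega)).2 rfl))
  · intro v w hv hw
    rw [hψ v hv, hψ w hw]
    exact φ.map_adj_iff (v := ⟨v, (hA v).2 hv⟩) (w := ⟨w, (hA w).2 hw⟩)
  · intro v w hv hw he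
    rw [hψ v hv, hψ w hw] at he
    exact congrArg Subtype.val (φ.injective (Subtype.ext he))
  · intro x h1 h2
    obtain ⟨⟨v, hv⟩, hvx⟩ := φ.surjective ⟨x, hB x h1 h2⟩
    refine ⟨v, (hA v).1 hv, ?_⟩
    rw [hψ v ((hA v).1 hv), hvx]
  · obtain ⟨v, hv⟩ := h.top_nonempty
    obtain ⟨u, hu, -⟩ := exists_mem_of_distFrom_lt (G := G) (N0 := N0) (v := v)
      (n := (D + 1 : ℕ))
      (by rw [show distFrom G N0 v = D from hv]; exact_mod_cast Nat.lt_succ_self _)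
    refine ⟨u, (mem_levelSet_iff (Nat.zero_le _)).1 ?_⟩
    exact le_antisymm ((iInf₂_le u hu).trans (by simp)) (by simp)
  · intro hk
    have := h.parity_first hk
    rwa [show levelSet G N0 0 = {v | levelOf G N0 D v = 0} from
      Set.ext fun v => mem_levelSet_iff (Nat.zero_le _)] at this

end repeatable

theorem repeatable_yields_upper_bound (k g : ℕ) (hk : 3 ≤ k) (hg : 3 ≤ g)
    {V : Type*} [Fintype V] (G : SimpleGraph V) (N0 : Set V) (D : ℕ)
    (h : IsRepeatable k g G N0 D) :
    fRatio k g ≤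
      ((⋃ i ∈ Finset.range (D - g + 1), levelSet G N0 i).ncard : ℝ) / (D + 1 - g : ℕ) := by
  obtain ⟨ψ, hψ⟩ := h.exists_isStrip hg
  have hlong := h.long
  refine (hψ.fRatio_le hk).trans_eq ?_
  congr 2
  change {v | levelOf G N0 D v < D + 1 - g}.ncard = _
  refine congrArg Set.ncard (Set.ext fun v => ?_)
  simp only [Set.mem_iUnion, Finset.mem_range, exists_prop]
  constructor
  · intro hv
    rw [Set.mem_ofPred_eq] at hv
    exact ⟨_, by omega, (mem_levelSet_iff (D := D) (by omega)).2 rfl⟩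
  · rintro ⟨i, hi, hv⟩
    rw [mem_levelSet_iff (D := D) (by omega)] at hv
    rw [Set.mem_ofPred_eq]
    omega
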